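/- For every integer n ≥ 3 there exist a Ważewski dendrite X of order n and a finitely generated subgroup G of Homeo(X), dense in Homeo(X), such that for every branch point p of X the stabilizer {g ∈ G : g(p) = p} is a maximal proper subgroup of G. -/

import Mathlib

open Topology

/-- The set of connected components of a subset `S` of `X`. -/
def setComponents (X : Type*) [TopologicalSpace X] (S : Set X) : Set (Set X) :=
  {C | ∃ x ∈ S, C = connectedComponentIn S x}

/-- The order of a point `p` of `X`: the number of connected components of `X \ {p}`. -/
noncomputable def ptOrder (X : Type*) [TopologicalSpace X] (p : X) : ℕ :=
  (setComponents X {p}ᶜ).ncard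

/-- A dendrite: a nonempty, compact, connected, locally connected metrizable space
containing no subspace homeomorphic to the circle. -/
def IsDendrite (X : Type*) [TopologicalSpace X] : Prop :=
  Nonempty X ∧ CompactSpace X ∧ ConnectedSpace X ∧ LocallyConnectedSpace X ∧
    TopologicalSpace.MetrizableSpace X ∧
    ∀ S : Set X, IsEmpty (S ≃ₜ Circle)

/-- A Ważewski dendrite of order `n`: a dendrite all of whose points have order `1`, `2`
or `n`, and every arc (subspace homeomorphic to `[0,1]`) contains a point of order `n`. -/
def IsWazewskiDendrite (n : ℕ) (X : Type*) [TopologicalSpace X] : Prop :=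
  IsDendrite X ∧
  (∀ p : X, ptOrder X p = 1 ∨ ptOrder X p = 2 ∨ ptOrder X p = n) ∧
  ∀ A : Set X, Nonempty (A ≃ₜ unitInterval) → ∃ p ∈ A, ptOrder X p = n

/-- The group structure on self-homeomorphisms of `X`, with composition as product. -/
instance Homeomorph.instGroupSelf (X : Type*) [TopologicalSpace X] : Group (X ≃ₜ X) where
  mul f g := g.trans f
  one := Homeomorph.refl X
  inv := Homeomorph.symm
  mul_assoc _ _ _ := rfl
  one_mul _ := Homeomorph.ext fun _ => rfl
  mul_one _ := Homeomorph.ext fun _ => rfl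
  inv_mul_cancel := Homeomorph.self_trans_symm

/-- The compact-open topology on the group of self-homeomorphisms of `X` (for compact
metric `X`, this is the topology of uniform convergence). -/
instance Homeomorph.instTopSelf (X : Type*) [TopologicalSpace X] :
    TopologicalSpace (X ≃ₜ X) :=
  TopologicalSpace.induced (fun h : X ≃ₜ X => (h : C(X, X))) ContinuousMap.compactOpen

/-- The stabilizer of a point `p` in a subgroup `G` of the homeomorphism group. -/
def pointStab {X : Type*} [TopologicalSpace X] (G : Subgroup (X ≃ₜ X)) (p : X) :
    Subgroup G where
  carrier := {g : G | (g : X ≃ₜ X) p = p}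
  one_mem' := rfl
  mul_mem' := by
    intro a b ha hb
    simp only [Set.mem_setOf_eq] at *
    have h : ((a * b : G) : X ≃ₜ X) p = (a : X ≃ₜ X) ((b : X ≃ₜ X) p) := rfl
    rw [h, hb, ha]
  inv_mem' := by
    intro a ha
    simp only [Set.mem_setOf_eq] at *
    have h : ((a⁻¹ : G) : X ≃ₜ X) = (a : X ≃ₜ X).symm := rfl
    rw [h]
    nth_rewrite 1 [← ha]
    exact (a : X ≃ₜ X).symm_apply_apply p

section
open Topology Set

namespace Waz

/-- Addresses. -/
abbrev Sq (m : ℕ) := ℕ → Fin (m+3)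

variable {m : ℕ}

def scons (i : Fin (m+3)) (s : Sq m) : Sq m := fun k => Nat.casesOn k i s
def stail (s : Sq m) : Sq m := fun k => s (k+1)

@[simp] lemma scons_zero (i : Fin (m+3)) (s : Sq m) : scons i s 0 = i := rfl
@[simp] lemma stail_scons (i : Fin (m+3)) (s : Sq m) : stail (scons i s) = s := rfl
lemma scons_stail (s : Sq m) : scons (s 0) (stail s) = s := by
  funext k; cases k <;> rfl

lemma continuous_stail : Continuous (stail : Sq m → Sq m) :=
  continuous_pi fun k => continuous_apply (k+1)

lemma continuous_scons (i : Fin (m+3)) : Continuous (scons i : Sq m → Sq m) := by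
  refine continuous_pi fun k => ?_
  cases k with
  | zero => exact continuous_const
  | succ k => exact continuous_apply k

def sτ : Sq m := fun _ => 1
def sι : Sq m := scons 0 sτ

lemma scons_τ : scons 1 (sτ : Sq m) = sτ := by
  funext k; cases k <;> rfl

noncomputable def cf (i : Fin (m+3)) : ℝ := if i = 0 then -1 else if i = 1 then 1 else 0

lemma abs_cf (i : Fin (m+3)) : |cf i| ≤ 1 := by
  unfold cf; split_ifs <;> simp

noncomputable def hterm (k : ℕ) (s : Sq m) : ℝ :=
  (1/2)^(k+1) * ∏ l ∈ Finset.range k, cf (s l)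

lemma hterm_bound (k : ℕ) (s : Sq m) : ‖hterm k s‖ ≤ (1/2 : ℝ)^(k+1) := by
  unfold hterm
  rw [norm_mul, Real.norm_eq_abs, Real.norm_eq_abs, abs_of_nonneg (by positivity),
    Finset.abs_prod]
  have : ∏ l ∈ Finset.range k, |cf (s l)| ≤ 1 :=
    Finset.prod_le_one (fun _ _ => abs_nonneg _) (fun _ _ => abs_cf _)
  have h2 : (0:ℝ) ≤ (1/2)^(k+1) := by positivity
  nlinarith

lemma summable_bd : Summable fun k : ℕ => (1/2 : ℝ)^(k+1) :=
  (summable_nat_add_iff 1).2 summable_geometric_two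

noncomputable def hh (s : Sq m) : ℝ := ∑' k, hterm k s

lemma continuous_hh : Continuous (hh : Sq m → ℝ) := by
  refine continuous_tsum (fun k => ?_) summable_bd hterm_bound
  unfold hterm
  refine continuous_const.mul (continuous_finsetProd _ fun l _ => ?_)
  exact (continuous_of_discreteTopology (f := cf)).comp (continuous_apply l)

lemma hh_scons (i : Fin (m+3)) (s : Sq m) : hh (scons i s) = 1/2 + cf i / 2 * hh s := by
  unfold hh
  have hs : ∀ s : Sq m, Summable fun k => hterm k s := fun s =>
    Summable.of_norm_bounded summable_bd (fun k => hterm_bound k s)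
  rw [(hs _).tsum_eq_zero_add, ← tsum_mul_left]
  congr 1
  · simp [hterm]
  · congr 1; funext k
    simp only [hterm, Finset.prod_range_succ', scons_zero]
    have : ∀ l, scons i s (l+1) = s l := fun l => rfl
    simp only [this]
    ring

lemma hh_τ : hh (sτ : Sq m) = 1 := by
  have := hh_scons 1 (sτ : Sq m)
  rw [scons_τ] at this
  have h1 : cf (1 : Fin (m+3)) = 1 := by simp [cf]
  rw [h1] at this
  linarith

lemma hh_ι : hh (sι : Sq m) = 0 := by
  rw [sι, hh_scons, hh_τ]; simp [cf]; norm_num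

open Classical in
noncomputable def sr (i : Fin (m+3)) (s : Sq m) : Sq m := if s 0 = i then stail s else sι

lemma continuous_sr (i : Fin (m+3)) : Continuous (sr i : Sq m → Sq m) := by
  unfold sr
  have hc : IsClopen {s : Sq m | s 0 = i} :=
    (isClopen_discrete {i}).preimage (continuous_apply (A := fun _ => Fin (m+3)) 0)
  refine continuous_if (fun a ha => ?_) continuous_stail.continuousOn continuous_const.continuousOn
  rw [hc.frontier_eq] at ha
  exact ha.elim

@[simp] lemma sr_same (i : Fin (m+3)) (s : Sq m) : sr i (scons i s) = s := by simp [sr]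
lemma sr_ne {i j : Fin (m+3)} (h : j ≠ i) (s : Sq m) : sr i (scons j s) = sι := by simp [sr, h]

noncomputable def PhiF (m : ℕ) : List (Fin (m+3)) → Sq m → ℝ
  | [] => hh
  | i :: w => fun s => PhiF m w (sr i s)

lemma continuous_PhiF (w : List (Fin (m+3))) : Continuous (PhiF m w) := by
  induction w with
  | nil => exact continuous_hh
  | cons i w ih => exact ih.comp (continuous_sr i)

noncomputable def Phi (s : Sq m) : List (Fin (m+3)) → ℝ := fun w => PhiF m w s

lemma continuous_Phi : Continuous (Phi : Sq m → _) := continuous_pi continuous_PhiF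

lemma Phi_scons {s t : Sq m} (i : Fin (m+3)) (h : Phi s = Phi t) :
    Phi (scons i s) = Phi (scons i t) := by
  funext w
  cases w with
  | nil =>
    have := congrFun h []
    simp only [Phi, PhiF] at this ⊢
    rw [hh_scons, hh_scons, this]
  | cons j w =>
    by_cases hj : i = j
    · subst hj
      simpa [Phi, PhiF] using congrFun h w
    · simp [Phi, PhiF, sr_ne hj]

lemma Phi_sr {s t : Sq m} (i : Fin (m+3)) (h : Phi s = Phi t) :
    Phi (sr i s) = Phi (sr i t) := by
  funext w; exact congrFun h (i :: w)

/-- The dendrite. -/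
def X (m : ℕ) : Type := Set.range (Phi : Sq m → _)

noncomputable instance : TopologicalSpace (X m) := inferInstanceAs (TopologicalSpace (Set.range _))
instance : TopologicalSpace.MetrizableSpace (X m) :=
  inferInstanceAs (TopologicalSpace.MetrizableSpace (Set.range (Phi : Sq m → _)))
instance : CompactSpace (X m) :=
  isCompact_iff_compactSpace.1 (isCompact_range (continuous_Phi (m := m)))

noncomputable def pr (s : Sq m) : X m := ⟨Phi s, s, rfl⟩

lemma continuous_pr : Continuous (pr : Sq m → X m) :=
  continuous_Phi.subtype_mk _

lemma pr_surj : Function.Surjective (pr : Sq m → X m) := by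
  rintro ⟨_, s, rfl⟩; exact ⟨s, rfl⟩

lemma pr_eq {s t : Sq m} : pr s = pr t ↔ Phi s = Phi t := Subtype.ext_iff

lemma quot_pr : IsQuotientMap (pr : Sq m → X m) :=
  (continuous_pr.isClosedMap).isQuotientMap continuous_pr pr_surj

noncomputable def f (i : Fin (m+3)) (x : X m) : X m := pr (scons i (pr_surj x).choose)

lemma f_pr (i : Fin (m+3)) (s : Sq m) : f i (pr s) = pr (scons i s) := by
  have := (pr_surj (pr s)).choose_spec
  exact pr_eq.2 (Phi_scons i (pr_eq.1 this))

lemma continuous_f (i : Fin (m+3)) : Continuous (f i : X m → X m) := by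
  rw [quot_pr.continuous_iff]
  have : f i ∘ pr = (pr ∘ scons i : Sq m → X m) := by funext s; exact f_pr i s
  rw [this]
  exact continuous_pr.comp (continuous_scons i)

noncomputable def r (i : Fin (m+3)) (x : X m) : X m := pr (sr i (pr_surj x).choose)

lemma r_pr (i : Fin (m+3)) (s : Sq m) : r i (pr s) = pr (sr i s) := by
  have := (pr_surj (pr s)).choose_spec
  exact pr_eq.2 (Phi_sr i (pr_eq.1 this))

lemma continuous_r (i : Fin (m+3)) : Continuous (r i : X m → X m) := by
  rw [quot_pr.continuous_iff]
  have : r i ∘ pr = (pr ∘ sr i : Sq m → X m) := by funext s; exact r_pr i s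
  rw [this]
  exact continuous_pr.comp (continuous_sr i)

noncomputable def ι : X m := pr sι
noncomputable def τ : X m := pr sτ
noncomputable def c : X m := f 0 ι

lemma f0τ : f 0 (τ : X m) = ι := by rw [τ, f_pr]; rfl
lemma f1τ : f 1 (τ : X m) = τ := by rw [τ, f_pr, scons_τ]

lemma ι_ne_τ : (ι : X m) ≠ τ := by
  intro h
  have := congrFun (pr_eq.1 h) []
  simp only [Phi, PhiF] at this
  rw [hh_ι, hh_τ] at this
  norm_num at this

@[simp] lemma r_f (i : Fin (m+3)) (x : X m) : r i (f i x) = x := by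
  obtain ⟨s, rfl⟩ := pr_surj x
  rw [f_pr, r_pr, sr_same]

lemma r_f_ne {i j : Fin (m+3)} (h : j ≠ i) (x : X m) : r i (f j x) = ι := by
  obtain ⟨s, rfl⟩ := pr_surj x
  rw [f_pr, r_pr, sr_ne h]; rfl

lemma f_inj (i : Fin (m+3)) : Function.Injective (f i : X m → X m) :=
  Function.LeftInverse.injective (r_f i)

lemma fι (i : Fin (m+3)) : f i (ι : X m) = c := by
  rw [c, ι, f_pr, f_pr, pr_eq]
  funext w
  cases w with
  | nil => simp only [Phi, PhiF]; rw [hh_scons, hh_scons, hh_ι]; simp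
  | cons j w =>
    have : ∀ i, sr j (scons i (sι : Sq m)) = sι := by
      intro i
      by_cases h : i = j
      · subst h; simp
      · exact sr_ne h _
    simp [Phi, PhiF, this]

lemma f_surj (x : X m) : ∃ i y, x = f i y := by
  obtain ⟨s, rfl⟩ := pr_surj x
  exact ⟨s 0, pr (stail s), by rw [f_pr, scons_stail]⟩

lemma f_ne {i j : Fin (m+3)} (h : i ≠ j) {x y : X m} (e : f i x = f j y) : x = ι ∧ y = ι := by
  constructor
  · rw [← r_f i x, e, r_f_ne h.symm]
  · rw [← r_f j y, ← e, r_f_ne h]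

lemma f_eq {i j : Fin (m+3)} {x y : X m} (e : f i x = f j y) (hx : x ≠ ι) : i = j ∧ x = y := by
  by_cases h : i = j
  · subst h; exact ⟨rfl, f_inj _ e⟩
  · exact absurd (f_ne h e).1 hx

lemma f_eq_c {i : Fin (m+3)} {x : X m} : f i x = c ↔ x = ι :=
  ⟨fun h => f_inj i (h.trans (fι i).symm), fun h => h ▸ fι i⟩

lemma r_c (i : Fin (m+3)) : r i (c : X m) = ι := by rw [← fι i, r_f]

/-- gluing -/
noncomputable def glue {Z : Type} (g : Fin (m+3) → X m → Z) (x : X m) : Z :=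
  g (f_surj x).choose (f_surj x).choose_spec.choose

lemma glue_f {Z : Type} {g : Fin (m+3) → X m → Z} (hg : ∀ i j, g i ι = g j ι) (i : Fin (m+3))
    (y : X m) : glue g (f i y) = g i y := by
  have key : ∀ i' y', f i y = f i' y' → g i' y' = g i y := by
    intro i' y' h
    by_cases hi : i = i'
    · subst hi; rw [f_inj i h]
    · obtain ⟨h1, h2⟩ := f_ne hi h
      rw [h2, h1, hg]
  exact key _ _ (f_surj (f i y)).choose_spec.choose_spec

lemma continuous_glue {Z : Type} [TopologicalSpace Z] {g : Fin (m+3) → X m → Z}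
    (hg : ∀ i j, g i ι = g j ι) (hc : ∀ i, Continuous (g i)) : Continuous (glue g) := by
  rw [quot_pr.continuous_iff]
  have : glue g ∘ pr = (fun p : Fin (m+3) × Sq m => g p.1 (pr p.2)) ∘
      (fun s : Sq m => (s 0, stail s)) := by
    funext s
    have : pr s = f (s 0) (pr (stail s)) := by rw [f_pr, scons_stail]
    simp only [Function.comp_apply]
    rw [this, glue_f hg]
  rw [this]
  refine Continuous.comp ?_ ((continuous_apply 0).prodMk continuous_stail)
  exact continuous_prod_of_discrete_left.2 fun i => (hc i).comp continuous_pr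

lemma c_ne_ι : (c : X m) ≠ ι := fun h => ι_ne_τ (f_inj 0 (h.trans f0τ.symm : f 0 ι = f 0 τ))
lemma c_ne_τ : (c : X m) ≠ τ := by
  intro h
  exact ι_ne_τ (f_inj 1 ((fι 1).trans (h.trans f1τ.symm)))

/-- word maps -/
noncomputable def fw : List (Fin (m+3)) → X m → X m
  | [] => id
  | i :: w => fun x => f i (fw w x)

lemma continuous_fw (w : List (Fin (m+3))) : Continuous (fw w : X m → X m) := by
  induction w with
  | nil => exact continuous_id
  | cons i w ih => exact (continuous_f i).comp ih

lemma fw_inj (w : List (Fin (m+3))) : Function.Injective (fw w : X m → X m) := by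
  induction w with
  | nil => exact Function.injective_id
  | cons i w ih => exact (f_inj i).comp ih

lemma fw_append (v w : List (Fin (m+3))) (x : X m) : fw (v ++ w) x = fw v (fw w x) := by
  induction v with
  | nil => rfl
  | cons i v ih => simp [fw, ih]

lemma fw_pr (w : List (Fin (m+3))) (s : Sq m) :
    ∃ t : Sq m, fw w (pr s) = pr t ∧ ∀ k (h : k < w.length), t k = w[k] := by
  induction w with
  | nil => exact ⟨s, rfl, by simp⟩
  | cons i w ih =>
    obtain ⟨t, h1, h2⟩ := ih
    refine ⟨scons i t, by simp [fw, h1, f_pr], ?_⟩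
    intro k h
    cases k with
    | zero => rfl
    | succ k => exact h2 k (by simpa using h)

lemma fw_surj (k : ℕ) (x : X m) : ∃ w y, w.length = k ∧ x = fw w y := by
  induction k generalizing x with
  | zero => exact ⟨[], x, rfl, rfl⟩
  | succ k ih =>
    obtain ⟨i, y, rfl⟩ := f_surj x
    obtain ⟨w, z, h, rfl⟩ := ih y
    exact ⟨i :: w, z, by simp [h], rfl⟩

lemma cover_cells (U V : Set (X m)) (hU : IsOpen U) (hV : IsOpen V) (h : U ∪ V = univ) :
    ∃ k, ∀ w : List (Fin (m+3)), w.length = k → range (fw w) ⊆ U ∨ range (fw w) ⊆ V := by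
  have key : ∃ k, ∀ s : Sq m, (∀ t ∈ PiNat.cylinder s k, pr t ∈ U) ∨
      (∀ t ∈ PiNat.cylinder s k, pr t ∈ V) := by
    have h1 : ∀ s : Sq m, ∃ k, (∀ t ∈ PiNat.cylinder s k, pr t ∈ U) ∨
      (∀ t ∈ PiNat.cylinder s k, pr t ∈ V) := by
      have aux : ∀ W : Set (X m), IsOpen W → ∀ s, pr s ∈ W →
          ∃ k, ∀ t ∈ PiNat.cylinder s k, pr t ∈ W := by
        intro W hW s hs
        obtain ⟨v, ⟨x, n, rfl⟩, hv1, hv2⟩ :=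
          (PiNat.isTopologicalBasis_cylinders (fun _ => Fin (m+3))).exists_subset_of_mem_open
          (show s ∈ pr ⁻¹' W from hs) (hW.preimage continuous_pr)
        refine ⟨n, fun t ht => hv2 ?_⟩
        rw [PiNat.mem_cylinder_iff_eq.1 hv1] at ht
        exact ht
      intro s
      have : pr s ∈ U ∪ V := h ▸ mem_univ _
      rcases this with hs | hs
      · obtain ⟨k, hk⟩ := aux U hU s hs
        exact ⟨k, Or.inl hk⟩
      · obtain ⟨k, hk⟩ := aux V hV s hs
        exact ⟨k, Or.inr hk⟩
    choose k hk using h1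
    obtain ⟨F, -, hF⟩ := isCompact_univ.elim_nhds_subcover (fun s : Sq m => PiNat.cylinder s (k s))
      (fun s _ => (PiNat.isOpen_cylinder _ s _).mem_nhds (PiNat.self_mem_cylinder s _))
    refine ⟨F.sup k, fun s => ?_⟩
    obtain ⟨t, ht, hst⟩ := mem_iUnion₂.1 (hF (mem_univ s))
    have hsub : PiNat.cylinder s (F.sup k) ⊆ PiNat.cylinder t (k t) := by
      rw [← PiNat.mem_cylinder_iff_eq.1 hst]
      exact PiNat.cylinder_anti s (Finset.le_sup ht)
    rcases hk t with h | h
    · exact Or.inl fun u hu => h u (hsub hu)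
    · exact Or.inr fun u hu => h u (hsub hu)
  obtain ⟨k, hk⟩ := key
  refine ⟨k, fun w hw => ?_⟩
  obtain ⟨t0, -, h0⟩ := fw_pr w (sτ : Sq m)
  have aux : ∀ x, ∃ t ∈ PiNat.cylinder t0 k, fw w x = pr t := by
    intro x
    obtain ⟨s, rfl⟩ := pr_surj x
    obtain ⟨t, h1, h2⟩ := fw_pr w s
    refine ⟨t, ?_, h1⟩
    rw [PiNat.mem_cylinder_iff]
    intro i hi
    rw [h2 i (by omega), h0 i (by omega)]
  rcases hk t0 with h | h
  · left; rintro _ ⟨x, rfl⟩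
    obtain ⟨t, ht, e⟩ := aux x
    rw [e]; exact h t ht
  · right; rintro _ ⟨x, rfl⟩
    obtain ⟨t, ht, e⟩ := aux x
    rw [e]; exact h t ht

lemma shrink (x : X m) (U : Set (X m)) (hU : IsOpen U) (hx : x ∈ U) :
    ∃ k, ∀ w : List (Fin (m+3)), w.length = k → x ∈ range (fw w) → range (fw w) ⊆ U := by
  obtain ⟨k, hk⟩ := cover_cells U {x}ᶜ hU isOpen_compl_singleton (by
    ext y; by_cases h : y = x
    · subst h; simp [hx]
    · simp [h])
  refine ⟨k, fun w hw hxw => (hk w hw).resolve_right fun h => h hxw rfl⟩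

end Waz
end

section
open Topology Set

namespace Waz
variable {m : ℕ}

instance : Nonempty (X m) := ⟨ι⟩

lemma clopen_aux (k : ℕ) : ∀ Z : Set (X m),
    (∀ w : List (Fin (m+3)), w.length = k → range (fw w) ⊆ Z ∨ range (fw w) ⊆ Zᶜ) →
    Z = ∅ ∨ Z = univ := by
  induction k with
  | zero =>
    intro Z h
    rcases h [] rfl with h | h
    · right; rw [eq_univ_iff_forall]; intro x; exact h ⟨x, rfl⟩
    · left; rw [eq_empty_iff_forall_notMem]; intro x; exact h ⟨x, rfl⟩
  | succ k ih =>
    intro Z h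
    have h1 : ∀ i : Fin (m+3), f i ⁻¹' Z = ∅ ∨ f i ⁻¹' Z = univ := by
      intro i
      refine ih _ fun w hw => ?_
      rcases h (i :: w) (by simp [hw]) with h | h
      · left; rintro _ ⟨x, rfl⟩; exact h ⟨x, rfl⟩
      · right; rintro _ ⟨x, rfl⟩; exact h ⟨x, rfl⟩
    by_cases hc : c ∈ Z
    · right; rw [eq_univ_iff_forall]; intro x
      obtain ⟨i, y, rfl⟩ := f_surj x
      rcases h1 i with h | h
      · have : (ι : X m) ∈ f i ⁻¹' Z := by simpa [fι] using hc
        rw [h] at this; exact this.elim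
      · exact (h ▸ mem_univ y : y ∈ f i ⁻¹' Z)
    · left; rw [eq_empty_iff_forall_notMem]; intro x hx
      obtain ⟨i, y, rfl⟩ := f_surj x
      rcases h1 i with h | h
      · exact (h ▸ hx : y ∈ (∅ : Set (X m)))
      · exact hc (by
          have : (ι : X m) ∈ f i ⁻¹' Z := h ▸ mem_univ _
          simpa [fι] using this)

instance : PreconnectedSpace (X m) := by
  rw [preconnectedSpace_iff_clopen]
  intro Z hZ
  obtain ⟨k, hk⟩ := cover_cells Z Zᶜ hZ.isOpen hZ.compl.isOpen (union_compl_self _)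
  exact clopen_aux k Z hk

instance : ConnectedSpace (X m) := ⟨inferInstance⟩

lemma precon_range {g : X m → X m} (hg : Continuous g) : IsPreconnected (range g) :=
  isPreconnected_range hg

lemma closed_range {g : X m → X m} (hg : Continuous g) : IsClosed (range g) :=
  (isCompact_range hg).isClosed

lemma finite_words (k : ℕ) : {w : List (Fin (m+3)) | w.length = k}.Finite :=
  List.finite_length_eq _ k

instance : LocallyConnectedSpace (X m) := by
  let bs : X m → ℕ → Set (X m) := fun x k => ⋃ w ∈ {w : List (Fin (m+3)) | w.length = k ∧ x ∈ range (fw w)}, range (fw w)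
  refine locallyConnectedSpace_of_connected_bases bs (fun _ _ => True) ?_ ?_
  · intro x
    rw [Filter.hasBasis_iff]
    intro U
    constructor
    · intro hU
      obtain ⟨V, hVU, hV, hx⟩ := mem_nhds_iff.1 hU
      obtain ⟨k, hk⟩ := shrink x V hV hx
      refine ⟨k, trivial, ?_⟩
      intro y hy
      obtain ⟨w, hw, hy⟩ := mem_iUnion₂.1 hy
      exact hVU (hk w hw.1 hw.2 hy)
    · rintro ⟨k, -, hk⟩
      refine Filter.mem_of_superset ?_ hk
      have hcl : IsClosed (⋃ w ∈ {w : List (Fin (m+3)) | w.length = k ∧ x ∉ range (fw w)}, range (fw w : X m → X m)) :=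
        ((finite_words k).subset fun w hw => hw.1).isClosed_biUnion
          fun w _ => closed_range (continuous_fw w)
      refine Filter.mem_of_superset (hcl.isOpen_compl.mem_nhds ?_) ?_
      · intro hx
        obtain ⟨w, hw, hy⟩ := mem_iUnion₂.1 hx
        exact hw.2 hy
      · intro y hy
        obtain ⟨w, z, hw, rfl⟩ := fw_surj k y
        by_cases hxw : x ∈ range (fw w)
        · exact mem_iUnion₂.2 ⟨w, ⟨hw, hxw⟩, ⟨z, rfl⟩⟩
        · exact (hy (mem_iUnion₂.2 ⟨w, ⟨hw, hxw⟩, ⟨z, rfl⟩⟩)).elim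
  · intro x k _
    refine isPreconnected_of_forall x ?_
    intro y hy
    obtain ⟨w, hw, hy⟩ := mem_iUnion₂.1 hy
    exact ⟨range (fw w), fun z hz => mem_iUnion₂.2 ⟨w, hw, hz⟩, hw.2, hy,
      precon_range (continuous_fw w)⟩

/-- same side -/
def SS (p x y : X m) : Prop := ∃ P : Set (X m), IsPreconnected P ∧ x ∈ P ∧ y ∈ P ∧ p ∉ P

lemma SS.symm {p x y : X m} (h : SS p x y) : SS p y x := by
  obtain ⟨P, h1, h2, h3, h4⟩ := h
  exact ⟨P, h1, h3, h2, h4⟩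

lemma SS.trans {p x y z : X m} (h : SS p x y) (h' : SS p y z) : SS p x z := by
  obtain ⟨P, h1, h2, h3, h4⟩ := h
  obtain ⟨Q, h1', h2', h3', h4'⟩ := h'
  exact ⟨P ∪ Q, h1.union y h3 h2' h1', Or.inl h2, Or.inr h3', by simp [h4, h4']⟩

lemma SS.refl {p x : X m} (h : x ≠ p) : SS p x x :=
  ⟨{x}, isPreconnected_singleton, rfl, rfl, fun e => h e.symm⟩

lemma SS.ne_left {p x y : X m} (h : SS p x y) : x ≠ p := by
  obtain ⟨P, h1, h2, h3, h4⟩ := h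
  rintro rfl; exact h4 h2

lemma SS.ne_right {p x y : X m} (h : SS p x y) : y ≠ p := h.symm.ne_left

lemma SS.map {p x y : X m} (h : SS p x y) (g : X m → X m) (hg : Continuous g) {q : X m}
    (hq : ∀ z, g z = q → z = p) : SS q (g x) (g y) := by
  obtain ⟨P, h1, h2, h3, h4⟩ := h
  refine ⟨g '' P, h1.image g hg.continuousOn, mem_image_of_mem g h2, mem_image_of_mem g h3, ?_⟩
  rintro ⟨z, hz, e⟩
  exact h4 (hq z e ▸ hz)

lemma SS.homeo {p x y : X m} (h : SS p x y) (g : X m ≃ₜ X m) : SS (g p) (g x) (g y) :=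
  h.map g g.continuous fun _ e => g.injective e

lemma SS_homeo {p x y : X m} (g : X m ≃ₜ X m) : SS (g p) (g x) (g y) ↔ SS p x y := by
  refine ⟨fun h => ?_, fun h => h.homeo g⟩
  simpa using h.homeo g.symm

lemma SS.ret {i : Fin (m+3)} {q x y : X m} (h : SS (f i q) x y) (hq : q ≠ ι) :
    SS q (r i x) (r i y) := by
  refine h.map (r i) (continuous_r i) ?_
  intro z e
  obtain ⟨j, z, rfl⟩ := f_surj z
  by_cases hj : j = i
  · subst hj; rw [r_f] at e; rw [e]
  · rw [r_f_ne hj] at e; exact (hq e.symm).elim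

/-- The star of all cells but one. -/
def St (i : Fin (m+3)) : Set (X m) := ⋃ j ∈ {j : Fin (m+3) | j ≠ i}, range (f j)

lemma f_mem_St {i j : Fin (m+3)} (h : j ≠ i) (x : X m) : f j x ∈ St i :=
  mem_iUnion₂.2 ⟨j, h, ⟨x, rfl⟩⟩

lemma mem_St {i : Fin (m+3)} {x : X m} : x ∈ St i ↔ ∃ j y, j ≠ i ∧ x = f j y := by
  constructor
  · intro h
    obtain ⟨j, hj, y, rfl⟩ := mem_iUnion₂.1 h
    exact ⟨j, y, hj, rfl⟩
  · rintro ⟨j, y, hj, rfl⟩; exact f_mem_St hj y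

lemma exists_ne' (i : Fin (m+3)) : ∃ j : Fin (m+3), j ≠ i := exists_ne i

lemma c_mem_St (i : Fin (m+3)) : (c : X m) ∈ St i := by
  obtain ⟨j, hj⟩ := exists_ne' i
  rw [← fι j]; exact f_mem_St hj _

lemma St_precon (i : Fin (m+3)) : IsPreconnected (St i : Set (X m)) := by
  refine isPreconnected_of_forall c ?_
  intro y hy
  obtain ⟨j, z, hj, rfl⟩ := mem_St.1 hy
  refine ⟨range (f j), ?_, ⟨ι, fι j⟩, ⟨z, rfl⟩, precon_range (continuous_f j)⟩
  rintro _ ⟨z, rfl⟩; exact f_mem_St hj z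

lemma St_closed (i : Fin (m+3)) : IsClosed (St i : Set (X m)) :=
  (Set.toFinite _).isClosed_biUnion fun j _ => closed_range (continuous_f j)

lemma f_notMem_St {i : Fin (m+3)} {x : X m} (h : x ≠ ι) : f i x ∉ St i := by
  intro hx
  obtain ⟨j, y, hj, e⟩ := mem_St.1 hx
  exact hj (f_eq e h).1.symm

lemma St_or (i : Fin (m+3)) (x : X m) : x ∈ St i ∨ ∃ y, y ≠ ι ∧ x = f i y := by
  obtain ⟨j, y, rfl⟩ := f_surj x
  by_cases hj : j = i
  · subst hj
    by_cases hy : y = ι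
    · left; rw [hy, fι]; exact c_mem_St j
    · exact Or.inr ⟨y, hy, rfl⟩
  · exact Or.inl (f_mem_St hj y)

/-- iterates of `f 1` -/
lemma tauAux (k : ℕ) : ∃ A : Set (X m), IsPreconnected A ∧ c ∈ A ∧ ι ∈ A ∧ τ ∉ A ∧
    ((f 1)^[k+1] c) ∉ A ∧ A ∪ range ((f 1)^[k+1]) = univ := by
  have h01 : (0 : Fin (m+3)) ≠ 1 := by simp
  have hι : (ι : X m) ∈ St 1 := by rw [← f0τ]; exact f_mem_St h01 _
  have hτ : (τ : X m) ∉ St 1 := by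
    have := f_notMem_St (i := (1 : Fin (m+3))) (ι_ne_τ (m := m)).symm
    rwa [f1τ] at this
  induction k with
  | zero =>
    refine ⟨St 1, St_precon 1, c_mem_St 1, hι, hτ, f_notMem_St c_ne_ι, ?_⟩
    rw [eq_univ_iff_forall]; intro x
    rcases St_or 1 x with h | ⟨y, -, rfl⟩
    · exact Or.inl h
    · exact Or.inr ⟨y, rfl⟩
  | succ k ih =>
    obtain ⟨A, h1, h2, h3, h4, h5, h6⟩ := ih
    refine ⟨St 1 ∪ f 1 '' A, ?_, Or.inl (c_mem_St 1), Or.inl hι, ?_, ?_, ?_⟩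
    · exact (St_precon 1).union c (c_mem_St 1) ⟨ι, h3, fι 1⟩ (h1.image _ (continuous_f 1).continuousOn)
    · rintro (h | ⟨y, hy, e⟩)
      · exact hτ h
      · have : y = τ := f_inj 1 (e.trans f1τ.symm)
        exact h4 (this ▸ hy)
    · rw [Function.iterate_succ_apply']
      rintro (h | ⟨y, hy, e⟩)
      · refine f_notMem_St ?_ h
        intro h; exact h5 (h ▸ h3)
      · exact h5 (f_inj 1 e ▸ hy)
    · rw [eq_univ_iff_forall]; intro x
      rcases St_or 1 x with h | ⟨y, -, rfl⟩
      · exact Or.inl (Or.inl h)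
      · rcases (h6 ▸ mem_univ y : y ∈ A ∪ range ((f 1)^[k+1])) with h | ⟨z, rfl⟩
        · exact Or.inl (Or.inr ⟨y, h, rfl⟩)
        · refine Or.inr ⟨z, ?_⟩
          rw [Function.iterate_succ_apply']

lemma fw_replicate (k : ℕ) (x : X m) : fw (List.replicate k 1) x = (f 1)^[k] x := by
  induction k with
  | zero => rfl
  | succ k ih => rw [List.replicate_succ, Function.iterate_succ_apply', ← ih]; rfl

lemma iter_τ (k : ℕ) : (f 1)^[k] (τ : X m) = τ := by
  induction k with
  | zero => rfl
  | succ k ih => rw [Function.iterate_succ_apply', ih, f1τ]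

lemma notMem_iter {y : X m} (hy : y ≠ τ) : ∃ k, y ∉ range ((f 1)^[k]) := by
  obtain ⟨k, hk⟩ := shrink (τ : X m) {y}ᶜ isOpen_compl_singleton (fun h => hy (by simpa using h.symm))
  refine ⟨k, fun ⟨z, h⟩ => ?_⟩
  refine hk (List.replicate k 1) (by simp) ⟨τ, by rw [fw_replicate, iter_τ]⟩
    ⟨z, by rw [fw_replicate, h]⟩ rfl

lemma iter_anti {k l : ℕ} (h : k ≤ l) : range ((f 1 : X m → X m)^[l]) ⊆ range ((f 1)^[k]) := by
  rintro _ ⟨x, rfl⟩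
  obtain ⟨d, rfl⟩ := Nat.exists_eq_add_of_le h
  exact ⟨(f 1)^[d] x, by rw [Function.iterate_add_apply]⟩

lemma SS_τ {x y : X m} (hx : x ≠ τ) (hy : y ≠ τ) : SS τ x y := by
  have key : ∀ x : X m, x ≠ τ → SS τ c x := by
    intro x hx
    obtain ⟨k, hk⟩ := notMem_iter hx
    obtain ⟨A, h1, h2, h3, h4, h5, h6⟩ := tauAux (m := m) k
    refine ⟨A, h1, h2, ?_, h4⟩
    rcases (h6 ▸ mem_univ x : x ∈ A ∪ range ((f 1)^[k+1])) with h | h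
    · exact h
    · exact (hk (iter_anti (Nat.le_succ k) h)).elim
  exact (key x hx).symm.trans (key y hy)

/-- The permutation homeomorphism -/
noncomputable def permH (σ : Equiv.Perm (Fin (m+3))) : X m ≃ₜ X m where
  toFun := glue fun i => f (σ i)
  invFun := glue fun i => f (σ.symm i)
  left_inv x := by
    obtain ⟨i, y, rfl⟩ := f_surj x
    rw [glue_f (by simp [fι]), glue_f (by simp [fι]), Equiv.symm_apply_apply]
  right_inv x := by
    obtain ⟨i, y, rfl⟩ := f_surj x
    rw [glue_f (by simp [fι]), glue_f (by simp [fι]), Equiv.apply_symm_apply]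
  continuous_toFun := continuous_glue (by simp [fι]) fun i => continuous_f _
  continuous_invFun := continuous_glue (by simp [fι]) fun i => continuous_f _

@[simp] lemma permH_f (σ : Equiv.Perm (Fin (m+3))) (i) (x : X m) :
    permH σ (f i x) = f (σ i) x :=
  glue_f (g := fun i => f (σ i)) (by simp [fι]) i x

@[simp] lemma permH_c (σ : Equiv.Perm (Fin (m+3))) : permH σ (c : X m) = c := by
  conv_lhs => rw [← fι 0]
  rw [permH_f, fι]

/-- the flip -/
noncomputable def fl : X m ≃ₜ X m := permH (Equiv.swap 0 1)

lemma fl_ι : fl (ι : X m) = τ := by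
  rw [← f0τ, fl, permH_f, Equiv.swap_apply_left, f1τ]
lemma fl_τ : fl (τ : X m) = ι := by
  conv_lhs => rw [← f1τ]
  rw [fl, permH_f, Equiv.swap_apply_right, f0τ]

lemma SS_ι {x y : X m} (hx : x ≠ ι) (hy : y ≠ ι) : SS ι x y := by
  rw [← SS_homeo fl, fl_ι]
  exact SS_τ (fun h => hx (fl.injective (h.trans fl_ι.symm))) (fun h => hy (fl.injective (h.trans fl_ι.symm)))

lemma SS_c_f (i : Fin (m+3)) {x y : X m} (hx : x ≠ ι) (hy : y ≠ ι) : SS c (f i x) (f i y) :=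
  (SS_ι hx hy).map (f i) (continuous_f i) fun _ e => f_eq_c.1 e

lemma not_SS_c {i j : Fin (m+3)} (h : i ≠ j) {x y : X m} (hx : x ≠ ι) (hy : y ≠ ι) :
    ¬ SS c (f i x) (f j y) := by
  rintro ⟨P, h1, h2, h3, h4⟩
  have hP : P ⊆ (St i)ᶜ ∪ (range (f i))ᶜ := by
    intro z hz
    by_cases hzi : z ∈ range (f i)
    · left
      obtain ⟨w, rfl⟩ := hzi
      exact f_notMem_St fun hw => h4 (by rw [hw, fι] at hz; exact hz)
    · exact Or.inr hzi
  obtain ⟨z, hz, hz1, hz2⟩ := h1 _ _ (St_closed i).isOpen_compl (closed_range (continuous_f i)).isOpen_compl hP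
    ⟨_, h2, f_notMem_St hx⟩ ⟨_, h3, by
      rintro ⟨w, e⟩
      exact hy (f_ne h e).2⟩
  rcases St_or i z with h | ⟨y, -, rfl⟩
  · exact hz1 h
  · exact hz2 ⟨y, rfl⟩

lemma SS_c_iff {i : Fin (m+3)} {x z : X m} (hx : x ≠ ι) : SS c (f i x) z ↔ ∃ y, y ≠ ι ∧ z = f i y := by
  constructor
  · intro h
    obtain ⟨j, y, rfl⟩ := f_surj z
    have hy : y ≠ ι := by
      intro hy; exact h.ne_right (by rw [hy, fι])
    by_cases hj : i = j
    · subst hj; exact ⟨y, hy, rfl⟩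
    · exact (not_SS_c hj hx hy h).elim
  · rintro ⟨y, hy, rfl⟩
    exact SS_c_f i hx hy

/-- branch points -/
def Br (x : X m) : Prop := ∃ w, x = fw w c

lemma Br_c : Br (c : X m) := ⟨[], rfl⟩
lemma Br_f (i : Fin (m+3)) {x : X m} (h : Br x) : Br (f i x) := by
  obtain ⟨w, rfl⟩ := h
  exact ⟨i :: w, rfl⟩

lemma ne_of_Br {x : X m} (h : Br x) : x ≠ τ ∧ x ≠ ι := by
  obtain ⟨w, rfl⟩ := h
  induction w with
  | nil => exact ⟨c_ne_τ, c_ne_ι⟩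
  | cons i w ih =>
    constructor
    · intro h
      rw [← f1τ] at h
      exact ih.1 (f_eq h ih.2).2
    · intro h
      rw [← f0τ] at h
      exact ih.1 (f_eq h ih.2).2

lemma Br_of_f {i : Fin (m+3)} {x : X m} (h : Br (f i x)) (hx : x ≠ ι) : Br x := by
  obtain ⟨w, h⟩ := h
  cases w with
  | nil => exact (hx (f_eq_c.1 h)).elim
  | cons j w => exact ⟨w, (f_eq h hx).2⟩

lemma sep_τ {y : X m} (hy : y ≠ τ) : ∃ p, Br p ∧ p ≠ y ∧ ¬ SS p τ y := by
  have key : ∀ k, ∀ y : X m, y ∉ range ((f 1)^[k]) → ∃ p, Br p ∧ p ≠ y ∧ ¬ SS p τ y := by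
    intro k
    induction k with
    | zero => intro y hy; exact (hy ⟨y, rfl⟩).elim
    | succ k ih =>
      intro y hy
      obtain ⟨i, z, rfl⟩ := f_surj y
      by_cases hz : z = ι ∨ i = 1
      · have : ∃ z', f i z = f 1 z' := by
          rcases hz with h | h
          · exact ⟨ι, by rw [h, fι, fι]⟩
          · exact ⟨z, by rw [h]⟩
        obtain ⟨z', h'⟩ := this
        rw [h'] at hy ⊢
        obtain ⟨p, h1, h2, h3⟩ := ih z' (by
          rintro ⟨w, rfl⟩; exact hy ⟨w, by rw [Function.iterate_succ_apply']⟩)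
        refine ⟨f 1 p, Br_f 1 h1, fun h => h2 (f_inj 1 h), fun h => h3 ?_⟩
        have := h.ret (ne_of_Br h1).2
        rw [r_f, ← f1τ, r_f] at this
        exact this
      · push Not at hz
        refine ⟨c, Br_c, fun h => hz.1 (f_eq_c.1 h.symm), ?_⟩
        rw [← f1τ]
        exact not_SS_c hz.2.symm ι_ne_τ.symm hz.1
  obtain ⟨k, hk⟩ := notMem_iter hy
  exact key k y hk

lemma Br_permH (σ : Equiv.Perm (Fin (m+3))) {x : X m} (h : Br x) : Br (permH σ x) := by
  obtain ⟨w, rfl⟩ := h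
  cases w with
  | nil => exact ⟨[], permH_c σ⟩
  | cons i w => exact ⟨σ i :: w, permH_f σ i _⟩

lemma fl_fl (x : X m) : fl (fl x) = x := by
  obtain ⟨i, y, rfl⟩ := f_surj x
  simp [fl]

lemma sep_ι {y : X m} (hy : y ≠ ι) : ∃ p, Br p ∧ p ≠ y ∧ ¬ SS p ι y := by
  obtain ⟨p, h1, h2, h3⟩ := sep_τ (y := fl y) (fun h => hy (fl.injective (h.trans fl_ι.symm)))
  refine ⟨fl p, Br_permH _ h1, fun h => h2 ?_, fun h => h3 ?_⟩
  · rw [← h, fl_fl]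
  · have := h.homeo fl
    rwa [fl_fl, fl_ι] at this

lemma sep {x y : X m} (h : x ≠ y) : ∃ p, Br p ∧ p ≠ x ∧ p ≠ y ∧ ¬ SS p x y := by
  have key : ∀ k, ∀ x y : X m, (∃ w : List (Fin (m+3)), w.length = k ∧ x ∈ range (fw w) ∧ y ∉ range (fw w)) →
      ∃ p, Br p ∧ p ≠ x ∧ p ≠ y ∧ ¬ SS p x y := by
    intro k
    induction k with
    | zero =>
      rintro x y ⟨w, hw, -, h⟩
      rw [List.length_eq_zero_iff] at hw
      subst hw
      exact (h ⟨y, rfl⟩).elim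
    | succ k ih =>
      rintro x y ⟨w, hw, hx, hy⟩
      cases w with
      | nil => simp at hw
      | cons i w =>
        obtain ⟨x, rfl⟩ := hx
        change ∃ p, Br p ∧ p ≠ f i (fw w x) ∧ p ≠ y ∧ ¬ SS p (f i (fw w x)) y
        obtain ⟨j, z, rfl⟩ := f_surj y
        by_cases hz : z = ι ∨ j = i
        · have : ∃ z', f j z = f i z' := by
            rcases hz with h | h
            · exact ⟨ι, by rw [h, fι, fι]⟩
            · exact ⟨z, by rw [h]⟩
          obtain ⟨z', h'⟩ := this
          rw [h'] at hy ⊢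
          obtain ⟨p, h1, h2, h3, h4⟩ := ih (fw w x) z' ⟨w, by simpa using hw, ⟨x, rfl⟩, by
            rintro ⟨u, rfl⟩; exact hy ⟨u, rfl⟩⟩
          refine ⟨f i p, Br_f i h1, fun h => h2 (f_inj i h), fun h => h3 (f_inj i h), fun h => h4 ?_⟩
          have := h.ret (ne_of_Br h1).2
          rwa [r_f, r_f] at this
        · push Not at hz
          by_cases hx : fw w x = ι
          · obtain ⟨p, h1, h2, h3⟩ := sep_ι hz.1
            refine ⟨f j p, Br_f j h1, ?_, fun h => h2 (f_inj j h), fun h => h3 ?_⟩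
            · intro h
              exact hz.2 (f_eq h (ne_of_Br h1).2).1
            · rw [hx, fι] at h
              have := h.ret (ne_of_Br h1).2
              rwa [r_f, r_c] at this
          · refine ⟨c, Br_c, fun h => hx (f_eq_c.1 h.symm), fun h => hz.1 (f_eq_c.1 h.symm), ?_⟩
            exact not_SS_c hz.2.symm hx hz.1
  obtain ⟨k, hk⟩ := shrink x {y}ᶜ isOpen_compl_singleton h
  obtain ⟨w, z, hw, e⟩ := fw_surj k x
  have hx : x ∈ range (fw w) := ⟨z, e.symm⟩
  exact key k x y ⟨w, hw, hx, fun hy => hk w hw hx hy rfl⟩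

end Waz
end

section
open Topology Set

namespace Waz
variable {m : ℕ}

lemma comp_eq {p x : X m} (hx : x ≠ p) : connectedComponentIn {p}ᶜ x = {y | SS p x y} := by
  ext y
  constructor
  · intro hy
    refine ⟨_, isPreconnected_connectedComponentIn, mem_connectedComponentIn hx, hy, ?_⟩
    intro h
    exact connectedComponentIn_subset _ _ h rfl
  · rintro ⟨P, h1, h2, h3, h4⟩
    refine h1.subset_connectedComponentIn h2 ?_ h3
    rintro z hz rfl
    exact h4 hz

lemma comps_eq (p : X m) : setComponents (X m) {p}ᶜ = {C | ∃ x, x ≠ p ∧ C = {y | SS p x y}} := by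
  ext C
  constructor
  · rintro ⟨x, hx, rfl⟩
    exact ⟨x, hx, comp_eq hx⟩
  · rintro ⟨x, hx, rfl⟩
    exact ⟨x, hx, (comp_eq hx).symm⟩

lemma side_eq {p x y : X m} (h : SS p x y) : {z | SS p x z} = {z | SS p y z} := by
  ext z
  exact ⟨fun h' => h.symm.trans h', fun h' => h.trans h'⟩

lemma side_open (p x : X m) : IsOpen {y | SS p x y} := by
  by_cases hx : x = p
  · have : {y | SS p x y} = ∅ := by
      rw [eq_empty_iff_forall_notMem]; intro y hy; exact SS.ne_left hy hx
    rw [this]; exact isOpen_empty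
  · rw [← comp_eq hx]; exact isOpen_compl_singleton.connectedComponentIn

lemma ptOrder_c : ptOrder (X m) c = m + 3 := by
  unfold ptOrder
  rw [comps_eq]
  have : {C : Set (X m) | ∃ x, x ≠ c ∧ C = {y | SS c x y}} =
      range (fun i : Fin (m+3) => {y | SS c (f i (τ : X m)) y}) := by
    ext C
    constructor
    · rintro ⟨x, hx, rfl⟩
      obtain ⟨i, y, rfl⟩ := f_surj x
      have hy : y ≠ ι := by rintro rfl; exact hx (fι i)
      exact ⟨i, side_eq (SS_c_f i ι_ne_τ.symm hy)⟩
    · rintro ⟨i, rfl⟩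
      exact ⟨_, fun h => ι_ne_τ (f_eq_c.1 h).symm, rfl⟩
  rw [this, ← Set.image_univ, Set.ncard_image_of_injective, Set.ncard_univ, Nat.card_eq_fintype_card,
    Fintype.card_fin]
  intro i j h
  by_contra hij
  have : f j τ ∈ {y | SS c (f i (τ : X m)) y} := by
    simp only at h
    rw [h]
    exact SS_c_f j ι_ne_τ.symm ι_ne_τ.symm
  exact not_SS_c hij ι_ne_τ.symm ι_ne_τ.symm this

lemma ptOrder_homeo (g : X m ≃ₜ X m) (p : X m) : ptOrder (X m) (g p) = ptOrder (X m) p := by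
  unfold ptOrder
  rw [comps_eq, comps_eq]
  have : {C : Set (X m) | ∃ x, x ≠ g p ∧ C = {y | SS (g p) x y}} =
      (fun C => g.symm ⁻¹' C) '' {C : Set (X m) | ∃ x, x ≠ p ∧ C = {y | SS p x y}} := by
    have key : ∀ x, {y | SS (g p) (g x) y} = g.symm ⁻¹' {y | SS p x y} := by
      intro x; ext y
      have := SS_homeo (p := p) (x := x) (y := g.symm y) g
      rw [g.apply_symm_apply] at this
      exact this
    ext C
    constructor
    · rintro ⟨x, hx, rfl⟩
      refine ⟨_, ⟨g.symm x, fun h => hx (by rw [← h, g.apply_symm_apply]), rfl⟩, ?_⟩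
      simp only
      rw [← key, g.apply_symm_apply]
    · rintro ⟨_, ⟨x, hx, rfl⟩, rfl⟩
      exact ⟨g x, fun h => hx (g.injective h), (key x).symm⟩
  rw [this, Set.ncard_image_of_injective]
  exact Set.preimage_injective.2 g.symm.surjective

lemma two_pieces (k : ℕ) (x : X m) (hx : ¬ Br x) : ∃ w y, ∃ A B : Set (X m), w.length = k ∧ x = fw w y ∧
    IsPreconnected A ∧ IsPreconnected B ∧ x ∉ A ∧ x ∉ B ∧ A ∪ B ∪ range (fw w) = univ ∧
    (A.Nonempty → fw w ι ∈ A) ∧ (B.Nonempty → fw w τ ∈ B) := by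
  induction k with
  | zero =>
    refine ⟨[], x, ∅, ∅, rfl, rfl, isPreconnected_empty, isPreconnected_empty, id, id, ?_, ?_, ?_⟩
    · rw [eq_univ_iff_forall]; intro y; exact Or.inr ⟨y, rfl⟩
    · intro h; simp at h
    · intro h; simp at h
  | succ k ih =>
    obtain ⟨w, y, A, B, h1, h2, h3, h4, h5, h6, h7, h8, h9⟩ := ih
    obtain ⟨i, y, rfl⟩ := f_surj y
    have hy : y ≠ ι := by
      rintro rfl; exact hx ⟨w, by rw [h2, fι]⟩
    have hfw : ∀ z, fw (w ++ [i]) z = fw w (f i z) := fun z => by rw [fw_append]; rfl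
    have hS : IsPreconnected (fw w '' St i) := (St_precon i).image _ (continuous_fw w).continuousOn
    have hxS : x ∉ fw w '' St i := by
      rintro ⟨z, hz, e⟩
      rw [h2] at e
      exact f_notMem_St hy (fw_inj w e ▸ hz)
    have hcS : fw w c ∈ fw w '' St i := mem_image_of_mem _ (c_mem_St i)
    have hAS : fw w ι ∈ fw w '' St i → IsPreconnected (A ∪ fw w '' St i) := by
      intro h
      rcases A.eq_empty_or_nonempty with rfl | hA
      · rw [empty_union]; exact hS
      · exact h3.union _ (h8 hA) h hS
    have hBS : fw w τ ∈ fw w '' St i → IsPreconnected (B ∪ fw w '' St i) := by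
      intro h
      rcases B.eq_empty_or_nonempty with rfl | hA
      · rw [empty_union]; exact hS
      · exact h4.union _ (h9 hA) h hS
    have hcov : ∀ z, z ∈ A ∨ z ∈ B ∨ z ∈ fw w '' St i ∨ z ∈ range (fw (w ++ [i])) := by
      intro z
      rcases (h7 ▸ mem_univ z : z ∈ A ∪ B ∪ range (fw w)) with (h | h) | ⟨u, rfl⟩
      · exact Or.inl h
      · exact Or.inr (Or.inl h)
      · rcases St_or i u with h | ⟨v, -, rfl⟩
        · exact Or.inr (Or.inr (Or.inl ⟨u, h, rfl⟩))
        · exact Or.inr (Or.inr (Or.inr ⟨v, hfw v⟩))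
    have hι : i ≠ 0 → fw w ι ∈ fw w '' St i := fun h => by
      refine mem_image_of_mem _ ?_
      rw [← f0τ]; exact f_mem_St h.symm _
    have hτ : i ≠ 1 → fw w τ ∈ fw w '' St i := fun h => by
      refine mem_image_of_mem _ ?_
      rw [← f1τ]; exact f_mem_St h.symm _
    have hlen : (w ++ [i]).length = k + 1 := by simp [h1]
    generalize fw w '' St i = S at *
    by_cases hi0 : i = 0
    · refine ⟨w ++ [i], y, B ∪ S, A, hlen, by rw [hfw, ← h2], hBS (hτ (by simp [hi0])), h3,
        by simp only [mem_union, not_or]; exact ⟨h6, hxS⟩, h5, ?_, ?_, ?_⟩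
      · rw [eq_univ_iff_forall]; intro z
        rcases hcov z with h | h | h | h <;> simp only [mem_union, h, true_or, or_true]
      · intro _; rw [hfw, fι]; exact Or.inr hcS
      · intro h; rw [hfw, hi0, f0τ]; exact h8 h
    · by_cases hi1 : i = 1
      · refine ⟨w ++ [i], y, A ∪ S, B, hlen, by rw [hfw, ← h2], hAS (hι hi0), h4,
          by simp only [mem_union, not_or]; exact ⟨h5, hxS⟩, h6, ?_, ?_, ?_⟩
        · rw [eq_univ_iff_forall]; intro z
          rcases hcov z with h | h | h | h <;> simp only [mem_union, h, true_or, or_true]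
        · intro _; rw [hfw, fι]; exact Or.inr hcS
        · intro h; rw [hfw, hi1, f1τ]; exact h9 h
      · refine ⟨w ++ [i], y, (A ∪ S) ∪ (B ∪ S), ∅, hlen, by rw [hfw, ← h2],
          (hAS (hι hi0)).union (fw w c) (Or.inr hcS) (Or.inr hcS) (hBS (hτ hi1)), isPreconnected_empty,
          by simp only [mem_union, not_or]; exact ⟨⟨h5, hxS⟩, ⟨h6, hxS⟩⟩, id, ?_, ?_, ?_⟩
        · rw [eq_univ_iff_forall]; intro z
          rcases hcov z with h | h | h | h <;> simp only [mem_union, h, true_or, or_true]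
        · intro _; rw [hfw, fι]; exact Or.inr (Or.inr hcS)
        · intro h; simp at h

lemma ptOrder_le {x : X m} (hx : ¬ Br x) : ptOrder (X m) x = 1 ∨ ptOrder (X m) x = 2 := by
  have key : ∀ a b d : X m, a ≠ x → b ≠ x → d ≠ x → SS x a b ∨ SS x a d ∨ SS x b d := by
    intro a b d ha hb hd
    obtain ⟨k, hk⟩ := shrink x ({a, b, d} : Set (X m))ᶜ (Set.toFinite _).isClosed.isOpen_compl
      (by simp only [mem_compl_iff, mem_insert_iff, mem_singleton_iff, not_or]
          exact ⟨ha.symm, hb.symm, hd.symm⟩)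
    obtain ⟨w, y, A, B, h1, h2, h3, h4, h5, h6, h7, -, -⟩ := two_pieces k x hx
    have hk' := hk w h1 ⟨y, h2.symm⟩
    have aux : ∀ z ∈ ({a, b, d} : Set (X m)), z ∈ A ∨ z ∈ B := by
      intro z hz
      rcases (h7 ▸ mem_univ z : z ∈ A ∪ B ∪ range (fw w)) with h | h
      · exact h
      · exact (hk' h hz).elim
    have hA : ∀ u v, u ∈ A → v ∈ A → SS x u v := fun u v hu hv => ⟨A, h3, hu, hv, h5⟩
    have hB : ∀ u v, u ∈ B → v ∈ B → SS x u v := fun u v hu hv => ⟨B, h4, hu, hv, h6⟩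
    have h1 := aux a (by simp)
    have h2 := aux b (by simp)
    have h3 := aux d (by simp)
    rcases h1 with h1 | h1 <;> rcases h2 with h2 | h2 <;> rcases h3 with h3 | h3 <;>
      first
      | exact Or.inl (hA _ _ h1 h2)
      | exact Or.inl (hB _ _ h1 h2)
      | exact Or.inr (Or.inl (hA _ _ h1 h3))
      | exact Or.inr (Or.inl (hB _ _ h1 h3))
      | exact Or.inr (Or.inr (hA _ _ h2 h3))
      | exact Or.inr (Or.inr (hB _ _ h2 h3))
  have hxc : c ≠ x := by rintro rfl; exact hx Br_c
  unfold ptOrder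
  rw [comps_eq]
  by_cases h : ∃ a, a ≠ x ∧ ¬ SS x c a
  · obtain ⟨a, ha, hac⟩ := h
    right
    rw [Set.ncard_eq_two]
    refine ⟨{y | SS x c y}, {y | SS x a y}, ?_, ?_⟩
    · intro h
      have : a ∈ {y | SS x a y} := SS.refl ha
      rw [← h] at this
      exact hac this
    · ext C
      constructor
      · rintro ⟨b, hb, rfl⟩
        rcases key c a b hxc ha hb with h | h | h
        · exact (hac h).elim
        · exact Or.inl (side_eq h).symm
        · exact Or.inr (side_eq h).symm
      · rintro (rfl | rfl)
        · exact ⟨c, hxc, rfl⟩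
        · exact ⟨a, ha, rfl⟩
  · push Not at h
    left
    rw [Set.ncard_eq_one]
    refine ⟨{y | SS x c y}, ?_⟩
    ext C
    constructor
    · rintro ⟨b, hb, rfl⟩
      exact (side_eq (h b hb)).symm
    · rintro rfl
      exact ⟨c, hxc, rfl⟩

lemma circle_precon (z : Circle) : IsPreconnected ({z}ᶜ : Set Circle) := by
  exact (Circle.isPathConnected_compl_singleton z).isConnected.isPreconnected

lemma no_circle (S : Set (X m)) : IsEmpty (S ≃ₜ Circle) := by
  refine ⟨fun e => ?_⟩
  have hne : ((e.symm 1 : S) : X m) ≠ (e.symm (-1) : S) := by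
    intro h
    have := e.symm.injective (Subtype.ext h)
    exact absurd this (by
      intro h
      have := congrArg (fun z : Circle => (z : ℂ).re) h
      norm_num at this)
  obtain ⟨p, -, h1, h2, h3⟩ := sep hne
  apply h3
  have hQ : IsPreconnected {z : Circle | ((e.symm z : S) : X m) ≠ p} := by
    by_cases hp : p ∈ S
    · have : {z : Circle | ((e.symm z : S) : X m) ≠ p} = {e ⟨p, hp⟩}ᶜ := by
        ext z
        simp only [mem_ofPred_eq, mem_compl_iff, mem_singleton_iff, not_iff_not]
        rw [← e.symm_apply_eq, Subtype.ext_iff]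
      rw [this]; exact circle_precon _
    · have : {z : Circle | ((e.symm z : S) : X m) ≠ p} = univ := by
        rw [eq_univ_iff_forall]; rintro z h
        exact hp (h ▸ (e.symm z).2)
      rw [this]
      exact isPreconnected_univ
  refine ⟨_, hQ.image (fun z => ((e.symm z : S) : X m)) (by fun_prop), ⟨1, h1.symm, rfl⟩,
    ⟨-1, h2.symm, rfl⟩, ?_⟩
  rintro ⟨z, hz, rfl⟩
  exact hz rfl

lemma isDendrite : IsDendrite (X m) :=
  ⟨inferInstance, inferInstance, inferInstance, inferInstance, inferInstance, no_circle⟩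

lemma arc (A : Set (X m)) (h : Nonempty (A ≃ₜ unitInterval)) : ∃ p ∈ A, Br p := by
  obtain ⟨e⟩ := h
  have hne : ((e.symm 0 : A) : X m) ≠ (e.symm 1 : A) := by
    intro h
    exact zero_ne_one (e.symm.injective (Subtype.ext h))
  obtain ⟨p, h0, h1, h2, h3⟩ := sep hne
  refine ⟨p, ?_, h0⟩
  by_contra hp
  refine h3 ⟨range (fun z => ((e.symm z : A) : X m)), isPreconnected_range (by fun_prop),
    ⟨0, rfl⟩, ⟨1, rfl⟩, ?_⟩
  rintro ⟨z, rfl⟩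
  exact hp (e.symm z).2

end Waz
end

section
open Topology Set

namespace Waz
variable {m : ℕ}

lemma hmul (a b : X m ≃ₜ X m) (x : X m) : (a * b) x = a (b x) := rfl
lemma hone (x : X m) : (1 : X m ≃ₜ X m) x = x := rfl
lemma hinv (a : X m ≃ₜ X m) (x : X m) : (a⁻¹) x = a.symm x := rfl
lemma hinv_mul (a : X m ≃ₜ X m) (x : X m) : (a⁻¹) (a x) = x := a.symm_apply_apply x
lemma hmul_inv (a : X m ≃ₜ X m) (x : X m) : a (a⁻¹ x) = x := a.apply_symm_apply x

/-- homeomorphism acting on cell `i` through `k`, identity elsewhere -/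
noncomputable def bl (i : Fin (m+3)) (k : X m ≃ₜ X m) (j : Fin (m+3)) (y : X m) : X m :=
  if j = i then f j (k y) else f j y

lemma bl_same (i : Fin (m+3)) (k : X m ≃ₜ X m) (y : X m) : bl i k i y = f i (k y) := if_pos rfl
lemma bl_ne {i j : Fin (m+3)} (h : j ≠ i) (k : X m ≃ₜ X m) (y : X m) : bl i k j y = f j y :=
  if_neg h

lemma bl_compat (i : Fin (m+3)) {k : X m ≃ₜ X m} (hk : k ι = ι) (a b : Fin (m+3)) :
    bl i k a ι = bl i k b ι := by
  simp only [bl, hk, fι, ite_self]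

lemma bl_cont (i : Fin (m+3)) (k : X m ≃ₜ X m) (j : Fin (m+3)) : Continuous (bl i k j) := by
  unfold bl
  split_ifs
  · exact (continuous_f j).comp k.continuous
  · exact continuous_f j

lemma symm_ι {k : X m ≃ₜ X m} (hk : k ι = ι) : k.symm ι = ι := by
  rw [k.symm_apply_eq, hk]

noncomputable def extH (i : Fin (m+3)) (k : X m ≃ₜ X m) (hk : k ι = ι) : X m ≃ₜ X m where
  toFun := glue (bl i k)
  invFun := glue (bl i k.symm)
  left_inv x := by
    obtain ⟨j, y, rfl⟩ := f_surj x
    rw [glue_f (bl_compat i hk)]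
    by_cases h : j = i
    · subst h
      rw [bl_same, glue_f (bl_compat j (symm_ι hk)), bl_same, k.symm_apply_apply]
    · rw [bl_ne h, glue_f (bl_compat i (symm_ι hk)), bl_ne h]
  right_inv x := by
    obtain ⟨j, y, rfl⟩ := f_surj x
    rw [glue_f (bl_compat i (symm_ι hk))]
    by_cases h : j = i
    · subst h
      rw [bl_same, glue_f (bl_compat j hk), bl_same, k.apply_symm_apply]
    · rw [bl_ne h, glue_f (bl_compat i hk), bl_ne h]
  continuous_toFun := continuous_glue (bl_compat i hk) (bl_cont i k)
  continuous_invFun := continuous_glue (bl_compat i (symm_ι hk)) (bl_cont i k.symm)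

lemma extH_same (i : Fin (m+3)) (k : X m ≃ₜ X m) (hk : k ι = ι) (y : X m) :
    extH i k hk (f i y) = f i (k y) := by
  have : extH i k hk (f i y) = bl i k i y := glue_f (bl_compat i hk) i y
  rw [this]; simp [bl]

lemma extH_ne {i j : Fin (m+3)} (h : j ≠ i) (k : X m ≃ₜ X m) (hk : k ι = ι) (y : X m) :
    extH i k hk (f j y) = f j y := by
  have : extH i k hk (f j y) = bl i k j y := glue_f (bl_compat i hk) j y
  rw [this]; simp [bl, h]

noncomputable def xa (j : Fin (m+3)) (y : X m) : X m :=
  if j = 0 then f 1 (f 0 (fl y)) else if j = 1 then f 0 y else f j y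

lemma f1c : f 1 (ι : X m) = c := fι 1

lemma xa_compat (a b : Fin (m+3)) : xa a (ι : X m) = xa b ι := by
  have : ∀ a : Fin (m+3), xa a (ι : X m) = c := by
    intro a; unfold xa; split_ifs
    · rw [fl_ι, f0τ, fι]
    · exact fι _
    · exact fι _
  rw [this, this]

lemma xa_cont (j : Fin (m+3)) : Continuous (xa j : X m → X m) := by
  unfold xa; split_ifs
  · exact (continuous_f 1).comp ((continuous_f 0).comp fl.continuous)
  · exact continuous_f _
  · exact continuous_f _

noncomputable def xb (i : Fin (m+3)) (y : X m) : X m :=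
  if i = 0 then glue xa y else f 1 (f i y)

lemma xb_compat (a b : Fin (m+3)) : xb a (ι : X m) = xb b ι := by
  have : ∀ a : Fin (m+3), xb a (ι : X m) = f 1 c := by
    intro a; unfold xb; split_ifs
    · rw [← f0τ, glue_f xa_compat]; simp [xa, fl_τ, fι]
    · rw [fι]
  rw [this, this]

lemma xb_cont (j : Fin (m+3)) : Continuous (xb j : X m → X m) := by
  unfold xb; split_ifs
  · exact continuous_glue xa_compat xa_cont
  · exact (continuous_f _).comp (continuous_f _)

noncomputable def ya (j : Fin (m+3)) (y : X m) : X m :=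
  if j = 0 then f 0 (f 0 (fl y)) else f j y

lemma ya_compat (a b : Fin (m+3)) : ya a (ι : X m) = ya b ι := by
  have : ∀ a : Fin (m+3), ya a (ι : X m) = c := by
    intro a; unfold ya; split_ifs
    · rw [fl_ι, f0τ, fι]
    · exact fι _
  rw [this, this]

lemma ya_cont (j : Fin (m+3)) : Continuous (ya j : X m → X m) := by
  unfold ya; split_ifs
  · exact (continuous_f 0).comp ((continuous_f 0).comp fl.continuous)
  · exact continuous_f _

noncomputable def yb (i : Fin (m+3)) (y : X m) : X m :=
  if i = 0 then f 0 (f 1 y) else if i = 1 then glue ya y else f 0 (f i y)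

lemma yb_compat (a b : Fin (m+3)) : yb a (ι : X m) = yb b ι := by
  have : ∀ a : Fin (m+3), yb a (ι : X m) = f 0 c := by
    intro a; unfold yb; split_ifs
    · rw [fι]
    · rw [← f0τ, glue_f ya_compat]; simp [ya, fl_τ, fι]
    · rw [fι]
  rw [this, this]

lemma yb_cont (j : Fin (m+3)) : Continuous (yb j : X m → X m) := by
  unfold yb; split_ifs
  · exact (continuous_f _).comp (continuous_f _)
  · exact continuous_glue ya_compat ya_cont
  · exact (continuous_f _).comp (continuous_f _)

noncomputable def x0 : X m ≃ₜ X m where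
  toFun := glue xb
  invFun := glue yb
  left_inv x := by
    obtain ⟨i, y, rfl⟩ := f_surj x
    rw [glue_f xb_compat]
    by_cases h : i = 0
    · subst h
      obtain ⟨j, y, rfl⟩ := f_surj y
      simp only [xb, if_true, glue_f xa_compat, xa]
      split_ifs with h0 h1
      · rw [glue_f yb_compat]; simp [yb, glue_f ya_compat, ya, fl_fl, h0]
      · rw [glue_f yb_compat]; simp [yb, h1]
      · rw [glue_f yb_compat]; simp [yb, h0, h1]
    · simp only [xb, h, if_false]
      rw [glue_f yb_compat]; simp [yb, glue_f ya_compat, ya, h]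
  right_inv x := by
    obtain ⟨i, y, rfl⟩ := f_surj x
    rw [glue_f yb_compat]
    by_cases h : i = 1
    · subst h
      obtain ⟨j, y, rfl⟩ := f_surj y
      simp only [yb, if_true, glue_f ya_compat, ya, one_ne_zero, if_false]
      split_ifs with h0
      · rw [glue_f xb_compat]; simp [xb, glue_f xa_compat, xa, fl_fl, h0]
      · rw [glue_f xb_compat]; simp [xb, h0]
    · simp only [yb, h, if_false]
      split_ifs with h0
      · rw [glue_f xb_compat]; simp [xb, glue_f xa_compat, xa, h0]
      · rw [glue_f xb_compat]; simp [xb, glue_f xa_compat, xa, h0, h]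
  continuous_toFun := continuous_glue xb_compat xb_cont
  continuous_invFun := continuous_glue yb_compat yb_cont

lemma x0_f (i : Fin (m+3)) (y : X m) : x0 (f i y) = xb i y := glue_f xb_compat i y

lemma x0_0 (j : Fin (m+3)) (y : X m) : x0 (f 0 (f j y)) = xa j y := by
  rw [x0_f]; simp only [xb, if_true]; exact glue_f xa_compat j y
lemma x0_00 (y : X m) : x0 (f 0 (f 0 y)) = f 1 (f 0 (fl y)) := by rw [x0_0]; simp [xa]
lemma x0_01 (y : X m) : x0 (f 0 (f 1 y)) = f 0 y := by rw [x0_0]; simp [xa]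
lemma x0_0j {j : Fin (m+3)} (h0 : j ≠ 0) (h1 : j ≠ 1) (y : X m) : x0 (f 0 (f j y)) = f j y := by
  rw [x0_0]; simp [xa, h0, h1]
lemma x0_j {j : Fin (m+3)} (h0 : j ≠ 0) (y : X m) : x0 (f j y) = f 1 (f j y) := by
  rw [x0_f]; simp [xb, h0]

lemma x0_ι : x0 (ι : X m) = ι := by
  conv_lhs => rw [← f0τ, ← f1τ]
  rw [x0_01, f0τ]

lemma permH_ι {σ : Equiv.Perm (Fin (m+3))} (h : σ 0 = 0) : permH σ (ι : X m) = ι := by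
  conv_lhs => rw [← f0τ]
  rw [permH_f, h, f0τ]

noncomputable def x1 : X m ≃ₜ X m := extH 1 x0 x0_ι

lemma x1_ι : x1 (ι : X m) = ι := by
  conv_lhs => rw [← f0τ]
  rw [x1, extH_ne (by simp), f0τ]

/-- generators of the auxiliary group -/
def Kg (m : ℕ) : Set (X m ≃ₜ X m) := (permH '' {σ | σ 0 = 0}) ∪ {x0, x1}

lemma Kg_ι {k : X m ≃ₜ X m} (h : k ∈ Kg m) : k ι = ι := by
  rcases h with ⟨σ, hσ, rfl⟩ | rfl | rfl
  · exact permH_ι hσ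
  · exact x0_ι
  · exact x1_ι

open Classical in
noncomputable def E0 (k : X m ≃ₜ X m) : X m ≃ₜ X m :=
  if h : k ι = ι then extH 0 k h else 1

lemma E0_0 {k : X m ≃ₜ X m} (h : k ι = ι) (y : X m) : E0 k (f 0 y) = f 0 (k y) := by
  rw [E0, dif_pos h, extH_same]
lemma E0_j {k : X m ≃ₜ X m} (h : k ι = ι) {j : Fin (m+3)} (hj : j ≠ 0) (y : X m) :
    E0 k (f j y) = f j y := by
  rw [E0, dif_pos h, extH_ne hj]

def Gg (m : ℕ) : Set (X m ≃ₜ X m) := range permH ∪ Kg m ∪ E0 '' Kg m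

lemma Kg_finite : (Kg m).Finite := ((Set.toFinite _).image _).union (Set.toFinite _)
lemma Gg_finite : (Gg m).Finite :=
  ((Set.finite_range _).union Kg_finite).union (Kg_finite.image _)

noncomputable def K (m : ℕ) : Subgroup (X m ≃ₜ X m) := Subgroup.closure (Kg m)
noncomputable def G (m : ℕ) : Subgroup (X m ≃ₜ X m) := Subgroup.closure (Gg m)

lemma G_fg : (G m).FG := (Subgroup.fg_iff _).2 ⟨Gg m, rfl, Gg_finite⟩

lemma K_le_G : K m ≤ G m :=
  Subgroup.closure_mono fun _ h => Or.inl (Or.inr h)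

lemma permH_mem (σ : Equiv.Perm (Fin (m+3))) : permH σ ∈ G m :=
  Subgroup.subset_closure (Or.inl (Or.inl ⟨σ, rfl⟩))

lemma K_ι {k : X m ≃ₜ X m} (h : k ∈ K m) : k ι = ι ∧ ∃ g ∈ G m, (∀ y, g (f 0 y) = f 0 (k y)) ∧
    ∀ j, j ≠ 0 → ∀ y, g (f j y) = f j y := by
  induction h using Subgroup.closure_induction with
  | mem k hk =>
    have := Kg_ι hk
    exact ⟨this, E0 k, Subgroup.subset_closure (Or.inr ⟨k, hk, rfl⟩), E0_0 this,
      fun j hj => E0_j this hj⟩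
  | one => exact ⟨rfl, 1, one_mem _, fun _ => rfl, fun _ _ _ => rfl⟩
  | mul a b _ _ ha hb =>
    obtain ⟨a1, g, hg, a2, a3⟩ := ha
    obtain ⟨b1, g', hg', b2, b3⟩ := hb
    refine ⟨by rw [hmul, b1, a1], g * g', mul_mem hg hg', fun y => ?_, fun j hj y => ?_⟩
    · rw [hmul, b2, a2]; rfl
    · rw [hmul, b3 j hj, a3 j hj]
  | inv a _ ha =>
    obtain ⟨a1, g, hg, a2, a3⟩ := ha
    refine ⟨symm_ι a1, g⁻¹, inv_mem hg, fun y => ?_, fun j hj y => ?_⟩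
    · apply g.injective
      rw [hmul_inv, a2, hmul_inv]
    · apply g.injective
      rw [hmul_inv, a3 j hj]

/-- orbit of `c` -/
def Orb (x : X m) : Prop := ∃ k ∈ K m, k x = c

lemma Orb_iff {g : X m ≃ₜ X m} (hg : g ∈ K m) {x y : X m} (h : g x = y) : Orb x ↔ Orb y := by
  subst h
  constructor
  · rintro ⟨k, hk, h⟩
    exact ⟨k * g⁻¹, mul_mem hk (inv_mem hg), by rw [hmul, hinv_mul, h]⟩
  · rintro ⟨k, hk, h⟩
    exact ⟨k * g, mul_mem hk hg, h⟩

lemma x0_mem : x0 ∈ K m := Subgroup.subset_closure (Or.inr (Or.inl rfl))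
lemma x1_mem : x1 ∈ K m := Subgroup.subset_closure (Or.inr (Or.inr rfl))
lemma perm0_mem {σ : Equiv.Perm (Fin (m+3))} (h : σ 0 = 0) : permH σ ∈ K m :=
  Subgroup.subset_closure (Or.inl ⟨σ, h, rfl⟩)

lemma x1_1 (y : X m) : x1 (f 1 y) = f 1 (x0 y) := extH_same _ _ _ _

lemma Orb_a {i j : Fin (m+3)} (hi : i ≠ 0) (hj : j ≠ 0) (y : X m) : Orb (f i y) ↔ Orb (f j y) :=
  Orb_iff (perm0_mem (σ := Equiv.swap i j) (Equiv.swap_apply_of_ne_of_ne hi.symm hj.symm)) (by simp)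

lemma Orb_f {x y : X m} (h : x0 x = y) : Orb (f 1 x) ↔ Orb (f 1 y) :=
  Orb_iff x1_mem (by rw [x1_1, h])

lemma Orb_c : Orb (c : X m) := ⟨1, one_mem _, rfl⟩
lemma Orb_1c : Orb (f 1 (c : X m)) := by
  rw [← Orb_iff x0_mem (x := c)]
  · exact Orb_c
  · conv_lhs => rw [← f1c]
    rw [x0_j (by simp), f1c]

/-- branch point of given level -/
def BrL (k : ℕ) (x : X m) : Prop := ∃ w : List (Fin (m+3)), w.length = k ∧ x = fw w c

lemma BrL_f (i : Fin (m+3)) {k : ℕ} {x : X m} (h : BrL k x) : BrL (k+1) (f i x) := by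
  obtain ⟨w, h, rfl⟩ := h
  exact ⟨i :: w, by simp [h], rfl⟩

lemma BrL_fl {k : ℕ} {x : X m} (h : BrL k x) : BrL k (fl x) := by
  obtain ⟨w, h, rfl⟩ := h
  cases w with
  | nil => exact ⟨[], h, permH_c _⟩
  | cons i w => exact ⟨Equiv.swap 0 1 i :: w, by simpa using h, permH_f _ _ _⟩

lemma BrL_cases {k : ℕ} {x : X m} (h : BrL k x) :
    x = c ∨ ∃ l i y, k = l + 1 ∧ BrL l y ∧ x = f i y := by
  obtain ⟨w, h, rfl⟩ := h
  cases w with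
  | nil => exact Or.inl rfl
  | cons i w => exact Or.inr ⟨w.length, i, fw w c, by simpa using h.symm, ⟨w, rfl, rfl⟩, rfl⟩

lemma Orb_all (k : ℕ) : ∀ x : X m, BrL k x → Orb x := by
  induction k using Nat.strong_induction_on with
  | _ k ih =>
    have h10 : (1 : Fin (m+3)) ≠ 0 := by simp
    have step1 : ∀ l i (y : X m), k = l + 1 → BrL l y → i ≠ 0 → Orb (f i y) := by
      intro l i y hk hy hi
      subst hk
      rw [Orb_a hi h10]
      rcases BrL_cases hy with rfl | ⟨l, j, y, rfl, hy2, rfl⟩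
      · exact Orb_1c
      by_cases hj : j = 0
      · subst hj
        rcases BrL_cases hy2 with rfl | ⟨l, j, y, rfl, hy3, rfl⟩
        · rw [Orb_f (y := c)]
          · exact Orb_1c
          · rw [← f1c, x0_01, fι, f1c]
        by_cases h0 : j = 0
        · subst h0
          rw [Orb_f (x0_00 y), ← Orb_iff x0_mem (x0_j h10 _)]
          exact ih (l+2) (by omega) _ (BrL_f _ (BrL_f _ (BrL_fl hy3)))
        by_cases h1 : j = 1
        · subst h1
          rw [Orb_f (x0_01 y)]
          exact ih (l+2) (by omega) _ (BrL_f _ (BrL_f _ hy3))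
        · rw [Orb_f (x0_0j h0 h1 y)]
          exact ih (l+2) (by omega) _ (BrL_f _ (BrL_f _ hy3))
      · rw [← Orb_iff x0_mem (x0_j hj y)]
        exact ih (l+1) (by omega) _ (BrL_f _ hy2)
    intro x hx
    rcases BrL_cases hx with rfl | ⟨l, i, y, hk, hy, rfl⟩
    · exact Orb_c
    by_cases hi : i = 0
    · subst hi; subst hk
      rcases BrL_cases hy with rfl | ⟨l, j, y, rfl, hy4, rfl⟩
      · rw [Orb_iff x0_mem (y := c)]
        · exact Orb_c
        · rw [← f1c, x0_01, fι, f1c]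
      by_cases h0 : j = 0
      · subst h0
        rw [Orb_iff x0_mem (x0_00 y)]
        exact step1 (l+1) 1 _ rfl (BrL_f _ (BrL_fl hy4)) h10
      by_cases h1 : j = 1
      · subst h1
        rw [Orb_iff x0_mem (x0_01 y)]
        exact ih (l+1) (by omega) _ (BrL_f _ hy4)
      · rw [Orb_iff x0_mem (x0_0j h0 h1 y)]
        exact ih (l+1) (by omega) _ (BrL_f _ hy4)
    · exact step1 l i y hk hy hi

lemma K_trans {x : X m} (h : Br x) : ∃ k ∈ K m, k x = c := by
  obtain ⟨w, rfl⟩ := h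
  exact Orb_all w.length _ ⟨w, rfl, rfl⟩

lemma ptOrder_Br {x : X m} (h : Br x) : ptOrder (X m) x = m + 3 := by
  obtain ⟨k, -, hk⟩ := K_trans h
  rw [← ptOrder_homeo k, hk, ptOrder_c]

lemma Br_iff (x : X m) : Br x ↔ ptOrder (X m) x = m + 3 := by
  refine ⟨ptOrder_Br, fun h => ?_⟩
  by_contra hx
  rcases ptOrder_le hx with h' | h' <;> omega

lemma Br_homeo (g : X m ≃ₜ X m) {x : X m} : Br (g x) ↔ Br x := by
  rw [Br_iff, Br_iff, ptOrder_homeo]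

lemma isWaz : IsWazewskiDendrite (m+3) (X m) := by
  refine ⟨isDendrite, fun p => ?_, fun A hA => ?_⟩
  · by_cases h : Br p
    · exact Or.inr (Or.inr (ptOrder_Br h))
    · rcases ptOrder_le h with h | h
      · exact Or.inl h
      · exact Or.inr (Or.inl h)
  · obtain ⟨p, hp, h⟩ := arc A hA
    exact ⟨p, hp, ptOrder_Br h⟩

end Waz
end

section
open Topology Set

namespace Waz
variable {m : ℕ}

lemma NF {p d : X m} (hp : Br p) (hd : d ≠ p) :
    ∃ u ∈ G m, ∃ y, y ≠ ι ∧ u p = c ∧ u d = f 0 y := by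
  obtain ⟨k, hk, hkp⟩ := K_trans hp
  obtain ⟨i, y, e⟩ := f_surj (k d)
  refine ⟨permH (Equiv.swap i 0) * k, mul_mem (permH_mem _) (K_le_G hk), y, ?_, ?_, ?_⟩
  · rintro rfl
    rw [fι, ← hkp] at e
    exact hd (k.injective e)
  · rw [hmul, hkp, permH_c]
  · rw [hmul, e, permH_f, Equiv.swap_apply_left]

lemma trans2 {p z : X m} (hp : Br p) (hz : Br z) (h : z ≠ p) :
    ∃ u ∈ G m, u p = c ∧ u z = f 0 c := by
  obtain ⟨u, hu, y, hy, h1, h2⟩ := NF hp h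
  have hb : Br y := by
    refine Br_of_f (i := 0) ?_ hy
    rw [← h2]; exact (Br_homeo u).2 hz
  obtain ⟨k, hk, e⟩ := K_trans hb
  obtain ⟨hkι, g, hg, g0, -⟩ := K_ι hk
  refine ⟨g * u, mul_mem hg hu, ?_, ?_⟩
  · rw [hmul, h1, ← fι 0, g0, hkι]
  · rw [hmul, h2, g0, e]

lemma T3 {p d z z' : X m} (hp : Br p) (hz : Br z) (hz' : Br z') (h : SS p d z) (h' : SS p d z') :
    ∃ g ∈ G m, g z = z' ∧ ∀ x, ¬ SS p d x → g x = x := by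
  obtain ⟨u, hu, y, hy, h1, h2⟩ := NF hp h.ne_left
  have key : ∀ x, SS p d x ↔ ∃ y, y ≠ ι ∧ u x = f 0 y := by
    intro x
    rw [← SS_homeo u, h1, h2, SS_c_iff hy]
  obtain ⟨a, ha, ea⟩ := (key z).1 h
  obtain ⟨b, hb, eb⟩ := (key z').1 h'
  have hab : Br a := Br_of_f (i := 0) (by rw [← ea]; exact (Br_homeo u).2 hz) ha
  have hbb : Br b := Br_of_f (i := 0) (by rw [← eb]; exact (Br_homeo u).2 hz') hb
  obtain ⟨k, hk, e⟩ := K_trans hab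
  obtain ⟨k', hk', e'⟩ := K_trans hbb
  have hkk : k'⁻¹ * k ∈ K m := mul_mem (inv_mem hk') hk
  obtain ⟨hkι, g, hg, g0, gj⟩ := K_ι hkk
  refine ⟨u⁻¹ * g * u, mul_mem (mul_mem (inv_mem hu) hg) hu, ?_, fun x hx => ?_⟩
  · apply u.injective
    rw [hmul, hmul, hmul_inv, ea, g0, hmul, e, ← e', hinv_mul, eb]
  · apply u.injective
    rw [hmul, hmul, hmul_inv]
    obtain ⟨i, w, ew⟩ := f_surj (u x)
    rw [ew]
    by_cases hi : i = 0
    · subst hi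
      by_cases hw : w = ι
      · rw [g0, hw, hkι]
      · exact absurd ((key x).2 ⟨w, hw, ew⟩) hx
    · exact gj i hi w

lemma L1 {p z x : X m} (hp : Br p) (hz : z ≠ p) (h : ¬ SS p z x) : SS z p x := by
  obtain ⟨u, hu, y, hy, h1, h2⟩ := NF hp hz
  rw [← SS_homeo u, h1, h2] at h ⊢
  obtain ⟨i, w, ew⟩ := f_surj (u x)
  rw [ew] at h ⊢
  have hne : f 0 y ≠ c := fun e => hy (f_eq_c.1 e)
  by_cases hw : w = ι
  · rw [hw, fι]; exact SS.refl hne.symm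
  by_cases hi : i = 0
  · subst hi; exact absurd (SS_c_f 0 hy hw) h
  · refine ⟨range (f i), precon_range (continuous_f i), ⟨ι, fι i⟩, ⟨w, rfl⟩, ?_⟩
    rintro ⟨v, hv⟩
    exact hy (f_ne hi hv).2

lemma sideperm (h : X m ≃ₜ X m) (hc : h c = c) : ∃ σ : Equiv.Perm (Fin (m+3)),
    ∀ i y, y ≠ ι → ∃ y', y' ≠ ι ∧ h (f i y) = f (σ i) y' := by
  have h0 : ∀ i : Fin (m+3), ∃ s t, t ≠ ι ∧ h (f i τ) = f s t := by
    intro i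
    obtain ⟨s, t, e⟩ := f_surj (h (f i τ))
    refine ⟨s, t, ?_, e⟩
    rintro rfl
    rw [fι, ← hc] at e
    exact ι_ne_τ (f_eq_c.1 (h.injective e)).symm
  choose s t ht e using h0
  have hs : Function.Injective s := by
    intro i j hij
    by_contra hne
    have := SS_c_f (s i) (ht i) (ht j)
    conv at this => rhs; rw [hij]
    rw [← e, ← e] at this
    have h2 : SS (h c) (h (f i τ)) (h (f j τ)) := by rw [hc]; exact this
    rw [SS_homeo] at h2
    exact not_SS_c hne ι_ne_τ.symm ι_ne_τ.symm h2
  refine ⟨Equiv.ofBijective s (Finite.injective_iff_bijective.1 hs), fun i y hy => ?_⟩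
  have := (SS_c_f i ι_ne_τ.symm hy).homeo h
  rw [hc, e, SS_c_iff (ht i)] at this
  exact this

lemma T2 {z p : X m} (hz : Br z) (hp : p ≠ z) (h : X m ≃ₜ X m) (hh : h z = z) :
    ∃ g ∈ G m, g z = z ∧ (∀ x, x ≠ z → SS z x (g (h x))) ∧
      (SS z p (h p) → ∀ x, SS z p x → g x = x) := by
  obtain ⟨u, hu, y, hy, h1, h2⟩ := NF hz hp
  have uc : u⁻¹ c = z := by rw [← h1, hinv_mul]
  obtain ⟨σ, hσ⟩ := sideperm (u * h * u⁻¹) (by rw [hmul, hmul, uc, hh, h1])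
  have gz : (u⁻¹ * permH σ⁻¹ * u) z = z := by rw [hmul, hmul, h1, permH_c, uc]
  refine ⟨u⁻¹ * permH σ⁻¹ * u, mul_mem (mul_mem (inv_mem hu) (permH_mem _)) hu, gz, ?_, ?_⟩
  · intro x hx
    obtain ⟨i, w, ew⟩ := f_surj (u x)
    have hw : w ≠ ι := by
      rintro rfl
      rw [fι, ← h1] at ew
      exact hx (u.injective ew)
    obtain ⟨w', hw', e⟩ := hσ i w hw
    have e2 : u (h x) = f (σ i) w' := by
      rw [← e, ← ew, hmul, hmul, hinv_mul]
    rw [← SS_homeo u, hmul, hmul, hmul_inv, e2, permH_f, h1, ew,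
      show σ⁻¹ (σ i) = i from σ.symm_apply_apply i]
    exact SS_c_f i hw hw'
  · intro hs x hx
    rw [← SS_homeo u, h1, h2, SS_c_iff hy] at hs hx
    obtain ⟨a, ha, ea⟩ := hs
    obtain ⟨b, hb, eb⟩ := hx
    obtain ⟨w', hw', e⟩ := hσ 0 y hy
    have e2 : u (h p) = f (σ 0) w' := by
      rw [← e, ← h2, hmul, hmul, hinv_mul]
    have h0 : σ 0 = 0 := (f_eq (e2.symm.trans ea) hw').1
    have h0' : σ⁻¹ 0 = 0 := by rw [Equiv.Perm.inv_eq_iff_eq, h0]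
    apply u.injective
    rw [hmul, hmul, hmul_inv, eb, permH_f, h0']

lemma r0ι : r 0 (ι : X m) = τ := by rw [← f0τ, r_f]
lemma r0τ : r 0 (τ : X m) = ι := by
  conv_lhs => rw [← f1τ]
  rw [r_f_ne (by simp)]
lemma r1ι : r 1 (ι : X m) = ι := by
  conv_lhs => rw [← f0τ]
  rw [r_f_ne (by simp)]
lemma r1τ : r 1 (τ : X m) = τ := by
  conv_lhs => rw [← f1τ]
  rw [r_f]

lemma median0 (w : List (Fin (m+3))) : ∀ q : X m, q = fw w c → SS q ι τ →
    ∃ a, Br a ∧ ¬ SS a ι τ ∧ ¬ SS a ι q ∧ ¬ SS a τ q := by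
  induction w with
  | nil =>
    intro q hq h
    have hq : q = c := hq
    have key := not_SS_c (show (0 : Fin (m+3)) ≠ 1 by simp) (ι_ne_τ (m := m)).symm
      (ι_ne_τ (m := m)).symm
    rw [f0τ, f1τ] at key
    exact absurd (hq ▸ h) key
  | cons j w ih =>
    intro q hq h
    have hq : q = f j (fw w c) := hq
    have hb : Br (fw w (c : X m)) := ⟨w, rfl⟩
    have hι := (ne_of_Br hb).2
    by_cases h0 : j = 0
    · subst h0
      rw [hq] at h
      have h2 := h.ret hι
      rw [r0ι, r0τ] at h2
      obtain ⟨a, ha, a1, a2, a3⟩ := ih _ rfl h2.symm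
      have haι := (ne_of_Br ha).2
      refine ⟨f 0 a, Br_f 0 ha, fun h => a1 ?_, fun h => a3 ?_, fun h => a2 ?_⟩
      · have := h.ret haι
        rw [r0ι, r0τ] at this; exact this.symm
      · have := h.ret haι
        rwa [r0ι, hq, r_f] at this
      · have := h.ret haι
        rwa [r0τ, hq, r_f] at this
    by_cases h1 : j = 1
    · subst h1
      rw [hq] at h
      have h2 := h.ret hι
      rw [r1ι, r1τ] at h2
      obtain ⟨a, ha, a1, a2, a3⟩ := ih _ rfl h2
      have haι := (ne_of_Br ha).2
      refine ⟨f 1 a, Br_f 1 ha, fun h => a1 ?_, fun h => a2 ?_, fun h => a3 ?_⟩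
      · have := h.ret haι
        rwa [r1ι, r1τ] at this
      · have := h.ret haι
        rwa [r1ι, hq, r_f] at this
      · have := h.ret haι
        rwa [r1τ, hq, r_f] at this
    · have k01 : (0 : Fin (m+3)) ≠ 1 := by simp
      have key1 := not_SS_c k01 (ι_ne_τ (m := m)).symm (ι_ne_τ (m := m)).symm
      have key2 := not_SS_c (Ne.symm h0) (ι_ne_τ (m := m)).symm hι
      have key3 := not_SS_c (Ne.symm h1) (ι_ne_τ (m := m)).symm hι
      rw [f0τ] at key1 key2
      rw [f1τ] at key1 key3
      exact ⟨c, Br_c, key1, hq ▸ key2, hq ▸ key3⟩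

lemma median {p z q : X m} (hp : Br p) (hz : Br z) (hq : Br q) (h1 : SS z p q) (h2 : SS q p z)
    (h3 : SS p z q) :
    ∃ a, Br a ∧ a ≠ p ∧ a ≠ z ∧ ¬ SS a p z ∧ ¬ SS a z q ∧ ¬ SS a p q := by
  obtain ⟨u, hu, up, uz⟩ := trans2 hp hz h3.ne_left
  have h3' := h3
  rw [← SS_homeo u, up, uz, SS_c_iff c_ne_ι] at h3'
  obtain ⟨q1, hq1, e1⟩ := h3'
  have h1' := h1
  rw [← SS_homeo u, up, uz, e1] at h1'
  have h4 := h1'.ret c_ne_ι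
  rw [r_c, r_f] at h4
  nth_rewrite 1 [← f0τ] at h4
  rw [SS_c_iff ι_ne_τ.symm] at h4
  obtain ⟨q2, hq2, e2⟩ := h4
  have h2' := h2
  rw [← SS_homeo u, up, uz, e1] at h2'
  have h5 := h2'.ret hq1
  rw [r_c, r_f, e2] at h5
  have h6 := h5.ret hq2
  rw [r0ι, r_c] at h6
  have hb : Br q2 := by
    refine Br_of_f (i := 0) ?_ hq2
    rw [← e2]
    refine Br_of_f (i := 0) ?_ hq1
    rw [← e1]
    exact (Br_homeo u).2 hq
  obtain ⟨w, hw⟩ := hb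
  obtain ⟨a, ha, a1, a2, a3⟩ := median0 w q2 hw h6.symm
  have haι := (ne_of_Br ha).2
  have hfa := (ne_of_Br (Br_f 0 ha)).2
  have ua : u (u⁻¹ (f 0 (f 0 a))) = f 0 (f 0 a) := hmul_inv _ _
  refine ⟨u⁻¹ (f 0 (f 0 a)), ?_, ?_, ?_, ?_, ?_, ?_⟩
  · exact (Br_homeo _).2 (Br_f 0 (Br_f 0 ha))
  · intro e
    rw [e, up] at ua
    exact hfa (f_eq_c.1 ua.symm)
  · intro e
    rw [e, uz] at ua
    exact haι (f_eq_c.1 (f_inj 0 ua.symm))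
  · rw [← SS_homeo u, ua, up, uz]
    intro h
    have := (h.ret hfa).ret haι
    rw [r_c, r_f, r0ι, r_c] at this
    exact a1 this.symm
  · rw [← SS_homeo u, ua, uz, e1, e2]
    intro h
    have := (h.ret hfa).ret haι
    rw [r_f, r_f, r_f, r_c] at this
    exact a2 this
  · rw [← SS_homeo u, ua, up, e1, e2]
    intro h
    have := (h.ret hfa).ret haι
    rw [r_f, r_f, r_c, r0ι] at this
    exact a3 this

lemma meet {p d : X m} (hp : Br p) (F : Finset (X m)) (hF : F.Nonempty) :
    (∀ q ∈ F, Br q ∧ SS p d q) →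
    ∃ z, Br z ∧ SS p d z ∧ (∀ q ∈ F, q = z ∨ ¬ SS z p q) ∧ ¬ ∃ e, ∀ q ∈ F, SS z e q := by
  induction hF using Finset.Nonempty.cons_induction with
  | singleton a =>
    intro h
    have := h a (by simp)
    refine ⟨a, this.1, this.2, by simp, ?_⟩
    rintro ⟨e, he⟩
    exact (he a (by simp)).ne_right rfl
  | cons q' F hq' hF ih =>
    intro h
    obtain ⟨z, hz, hdz, h1, h2⟩ := ih fun q hq => h q (by simp [hq])
    obtain ⟨hbq, hdq⟩ := h q' (by simp)
    have h2' : ¬ ∃ e, ∀ q ∈ Finset.cons q' F hq', SS z e q := by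
      rintro ⟨e, he⟩
      exact h2 ⟨e, fun q hq => he q (by simp [hq])⟩
    by_cases c1 : q' = z ∨ ¬ SS z p q'
    · refine ⟨z, hz, hdz, ?_, h2'⟩
      intro q hq
      rcases Finset.mem_cons.1 hq with rfl | hq
      · exact c1
      · exact h1 q hq
    push Not at c1
    obtain ⟨c1, c2⟩ := c1
    by_cases c3 : SS q' p z
    · obtain ⟨a, ha, ap, az, a1, a2, a3⟩ := median hp hz hbq c2 c3 (hdz.symm.trans hdq)
      have b1 : SS p a z := L1 ha ap.symm a1
      have b2 : SS z a p := L1 ha az.symm fun h => a1 h.symm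
      refine ⟨a, ha, hdz.trans b1.symm, ?_, ?_⟩
      · intro q hq
        rcases Finset.mem_cons.1 hq with rfl | hq
        · exact Or.inr a3
        right
        rcases h1 q hq with rfl | h3
        · exact a1
        · intro h4
          have : ¬ SS a z q := fun h5 => a1 (h4.trans h5.symm)
          exact h3 (b2.symm.trans (L1 ha az.symm this))
      · rintro ⟨e, he⟩
        obtain ⟨q, hq⟩ := hF
        have e1 := he q (by simp [hq])
        have e2 := he q' (by simp)
        refine a2 (SS.trans ?_ (e1.symm.trans e2))
        rcases h1 q hq with rfl | h3
        · exact SS.refl az.symm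
        · exact L1 hz az fun h => h3 (b2.symm.trans h)
    · refine ⟨q', hbq, hdq, ?_, ?_⟩
      · intro q hq
        rcases Finset.mem_cons.1 hq with rfl | hq
        · exact Or.inl rfl
        right
        rcases h1 q hq with rfl | h3
        · exact c3
        · intro h4
          have : ¬ SS q' z q := fun h5 => c3 (h4.trans h5.symm)
          exact h3 (c2.trans (L1 hbq c1.symm this))
      · rintro ⟨e, he⟩
        exact (he q' (by simp)).ne_right rfl

lemma inv_fix {g : X m ≃ₜ X m} {x : X m} (h : g x = x) : g⁻¹ x = x := by
  conv_lhs => rw [← h]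
  exact hinv_mul g x

lemma R (N : ℕ) : ∀ (F : Finset (X m)), F.card = N → ∀ (p d : X m), Br p →
    (∀ q ∈ F, Br q ∧ SS p d q) → ∀ h : X m ≃ₜ X m, h p = p → SS p d (h d) →
    ∃ g ∈ G m, (∀ x, ¬ SS p d x → g x = x) ∧ ∀ q ∈ F, g q = h q := by
  classical
  induction N using Nat.strong_induction_on with
  | _ N ih =>
  intro F hN p d hp hF h hhp hhd
  rcases F.eq_empty_or_nonempty with rfl | hne
  · exact ⟨1, one_mem _, fun _ _ => rfl, by simp⟩
  obtain ⟨z, hz, hdz, z1, z2⟩ := meet hp F hne hF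
  have hhz : SS p d (h z) := by
    have : SS (h p) (h d) (h z) := by
      rw [SS_homeo]; exact hdz
    rw [hhp] at this
    exact hhd.trans this
  obtain ⟨g0, hg0, g0z, g0f⟩ := T3 hp ((Br_homeo h).2 hz) hz hhz hdz
  have g0p : g0 p = p := g0f p fun h => h.ne_right rfl
  have hpz : p ≠ z := hdz.ne_right.symm
  obtain ⟨g1, hg1, g1z, g1s, g1f⟩ := T2 hz hpz (g0 * h) g0z
  have g1f' := g1f (by rw [hmul, hhp, g0p]; exact SS.refl hpz)
  set h2 : X m ≃ₜ X m := g1 * (g0 * h) with hh2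
  have h2z : h2 z = z := by rw [hh2, hmul, hmul, g0z, g1z]
  have h2s : ∀ x, x ≠ z → SS z x (h2 x) := g1s
  have claim : ∀ S : Finset (X m), S ⊆ F → ∃ g ∈ G m,
      (∀ x, (∀ e ∈ S, ¬ SS z e x) → g x = x) ∧
      ∀ q ∈ F, (∃ e ∈ S, SS z e q) → g q = h2 q := by
    intro S
    induction S using Finset.induction_on with
    | empty => exact fun _ => ⟨1, one_mem _, fun _ _ => rfl, by simp⟩
    | insert e S he ihS =>
      intro hS
      obtain ⟨g, hg, s1, s2⟩ := ihS fun x hx => hS (Finset.mem_insert_of_mem hx)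
      by_cases hez : e = z
      · refine ⟨g, hg, fun x hx => s1 x fun e' he' => hx e' (Finset.mem_insert_of_mem he'), ?_⟩
        rintro q hq ⟨e', he', hs⟩
        rcases Finset.mem_insert.1 he' with rfl | he'
        · exact absurd hez hs.ne_left
        · exact s2 q hq ⟨e', he', hs⟩
      by_cases hcov : ∃ e' ∈ S, SS z e' e
      · obtain ⟨e1, he1, hs1⟩ := hcov
        refine ⟨g, hg, fun x hx => s1 x fun e' he' => hx e' (Finset.mem_insert_of_mem he'), ?_⟩
        rintro q hq ⟨e', he', hs⟩
        rcases Finset.mem_insert.1 he' with rfl | he'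
        · exact s2 q hq ⟨e1, he1, hs1.trans hs⟩
        · exact s2 q hq ⟨e', he', hs⟩
      push Not at hcov
      have hlt : (F.filter fun q => SS z e q).card < N := by
        rw [← hN]
        refine Finset.card_lt_card (Finset.filter_ssubset.2 ?_)
        by_contra hcon
        push Not at hcon
        exact z2 ⟨e, hcon⟩
      obtain ⟨g', hg', t1, t2⟩ := ih _ hlt (F.filter fun q => SS z e q) rfl z e hz
        (fun q hq => ⟨(hF q (Finset.mem_filter.1 hq).1).1, (Finset.mem_filter.1 hq).2⟩) h2 h2z
        (h2s e hez)
      refine ⟨g' * g, mul_mem hg' hg, fun x hx => ?_, ?_⟩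
      · rw [hmul, s1 x fun e' he' => hx e' (Finset.mem_insert_of_mem he'),
          t1 x (hx e (Finset.mem_insert_self _ _))]
      · rintro q hq ⟨e', he', hs⟩
        rcases Finset.mem_insert.1 he' with rfl | he'
        · rw [hmul, s1 q fun e2 he2 h3 => hcov e2 he2 (h3.trans hs.symm)]
          exact t2 q (Finset.mem_filter.2 ⟨hq, hs⟩)
        · rw [hmul, s2 q hq ⟨e', he', hs⟩]
          refine t1 _ fun h3 => hcov e' he' ?_
          exact (hs.trans (h2s q hs.ne_right)).trans h3.symm
  obtain ⟨g, hg, s1, s2⟩ := claim F subset_rfl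
  refine ⟨g0⁻¹ * (g1⁻¹ * g), mul_mem (inv_mem hg0) (mul_mem (inv_mem hg1) hg), ?_, ?_⟩
  · intro x hx
    have hzx : SS z p x := L1 hp hpz.symm fun h => hx (hdz.trans h)
    have : g x = x := by
      refine s1 x fun e he h3 => ?_
      rcases z1 e he with rfl | h4
      · exact h3.ne_left rfl
      · exact h4 (hzx.trans h3.symm)
    rw [hmul, hmul, this, inv_fix (g1f' x hzx), inv_fix (g0f x hx)]
  · intro q hq
    have : g q = h2 q := by
      by_cases hqz : q = z
      · rw [hqz, h2z]
        exact s1 z fun e he h3 => h3.ne_right rfl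
      · exact s2 q hq ⟨q, hq, SS.refl hqz⟩
    rw [hmul, hmul, this, hh2, hmul, hmul, hinv_mul, hinv_mul]

lemma G_trans {p q : X m} (hp : Br p) (hq : Br q) : ∃ g ∈ G m, g p = q := by
  obtain ⟨k, hk, e⟩ := K_trans hp
  obtain ⟨k', hk', e'⟩ := K_trans hq
  exact ⟨k'⁻¹ * k, mul_mem (inv_mem (K_le_G hk')) (K_le_G hk), by rw [hmul, e, ← e', hinv_mul]⟩

lemma approx (h : X m ≃ₜ X m) (F : Finset (X m)) (hF : ∀ q ∈ F, Br q) :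
    ∃ g ∈ G m, ∀ q ∈ F, g q = h q := by
  have hk : ∃ k, ∀ q ∈ F, q ∉ range ((f 1)^[k+1]) := by
    classical
    have : ∀ q : X m, ∃ k, q ∈ F → q ∉ range ((f 1)^[k]) := by
      intro q
      by_cases hq : q ∈ F
      · obtain ⟨k, hk⟩ := notMem_iter (ne_of_Br (hF q hq)).1
        exact ⟨k, fun _ => hk⟩
      · exact ⟨0, fun h => absurd h hq⟩
    choose k hk using this
    refine ⟨F.sup k, fun q hq hr => hk q hq (iter_anti ?_ hr)⟩
    exact (Finset.le_sup hq).trans (Nat.le_succ _)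
  obtain ⟨k, hk⟩ := hk
  obtain ⟨A, A1, A2, -, -, A5, A6⟩ := tauAux (m := m) k
  set p : X m := (f 1)^[k+1] c with hp
  have hbp : Br p := ⟨List.replicate (k+1) 1, (fw_replicate _ _).symm⟩
  have hside : ∀ q ∈ F, Br q ∧ SS p c q := by
    intro q hq
    refine ⟨hF q hq, A, A1, A2, ?_, A5⟩
    have : q ∈ A ∪ range ((f 1)^[k+1]) := by rw [A6]; trivial
    exact this.resolve_right (hk q hq)
  have hcp : c ≠ p := fun e => A5 (e ▸ A2)
  obtain ⟨v, hv, hvp⟩ := G_trans ((Br_homeo h).2 hbp) hbp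
  obtain ⟨g1, hg1, g1p, g1s, -⟩ := T2 hbp hcp (v * h) hvp
  obtain ⟨g, hg, -, hgF⟩ := R _ F rfl p c hbp hside (g1 * (v * h))
    (by rw [hmul, hmul, hvp, g1p]) (g1s c hcp)
  refine ⟨v⁻¹ * (g1⁻¹ * g), mul_mem (inv_mem hv) (mul_mem (inv_mem hg1) hg), fun q hq => ?_⟩
  rw [hmul, hmul, hgF q hq, hmul, hmul, hinv_mul, hinv_mul]

end Waz
end

section
open Topology Set

namespace Waz
variable {m : ℕ}

lemma localA {x : X m} {U : Set (X m)} (hU : IsOpen U) (hx : x ∈ U) :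
    ∃ F : Finset (X m), (∀ q ∈ F, Br q) ∧ ∃ V : Set (X m), IsOpen V ∧ x ∈ V ∧
      ∀ g : X m ≃ₜ X m, (∀ q ∈ F, g q = q) → MapsTo g V U := by
  classical
  have h0 : ∀ y : X m, ∃ p e : X m, y ∉ U →
      Br p ∧ p ≠ x ∧ p ≠ y ∧ ¬ SS p x y ∧ Br e ∧ SS p e x := by
    intro y
    by_cases hy : y ∈ U
    · exact ⟨c, c, fun h => absurd hy h⟩
    have hxy : x ≠ y := by rintro rfl; exact hy hx
    obtain ⟨p, hp, p1, p2, p3⟩ := sep hxy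
    obtain ⟨e, he, e1, e2, e3⟩ := sep p1
    exact ⟨p, e, fun _ => ⟨hp, p1, p2, p3, he, L1 he e1.symm e3⟩⟩
  choose p e h0 using h0
  obtain ⟨T, hT, hcov⟩ := hU.isClosed_compl.isCompact.elim_nhds_subcover
    (fun y => {z | SS (p y) y z})
    (fun y hy => (side_open (p y) y).mem_nhds (SS.refl (h0 y hy).2.2.1.symm))
  refine ⟨T.image p ∪ T.image e, ?_, ⋂ y ∈ T, {z | SS (p y) x z}, ?_, ?_, ?_⟩
  · intro q hq
    rcases Finset.mem_union.1 hq with hq | hq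
    · obtain ⟨y, hy, rfl⟩ := Finset.mem_image.1 hq
      exact (h0 y (hT y hy)).1
    · obtain ⟨y, hy, rfl⟩ := Finset.mem_image.1 hq
      exact (h0 y (hT y hy)).2.2.2.2.1
  · exact isOpen_biInter_finset fun y _ => side_open _ _
  · exact mem_iInter₂.2 fun y hy => SS.refl (h0 y (hT y hy)).2.1.symm
  · intro g hg v hv
    by_contra hgv
    obtain ⟨y, hy, hs⟩ := mem_iUnion₂.1 (hcov hgv)
    have hs : SS (p y) y (g v) := hs
    obtain ⟨-, -, -, a4, -, a6⟩ := h0 y (hT y hy)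
    have hv : SS (p y) x v := mem_iInter₂.1 hv y hy
    have gp : g (p y) = p y := hg _ (Finset.mem_union_left _ (Finset.mem_image_of_mem _ hy))
    have ge : g (e y) = e y := hg _ (Finset.mem_union_right _ (Finset.mem_image_of_mem _ hy))
    have h3 := (a6.trans hv).homeo g
    rw [gp, ge] at h3
    exact a4 (a6.symm.trans (h3.trans hs.symm))

lemma globalA (h : X m ≃ₜ X m) {A U : Set (X m)} (hA : IsCompact A) (hU : IsOpen U)
    (hAU : MapsTo h A U) : ∃ F : Finset (X m), (∀ q ∈ F, Br q) ∧
      ∀ g : X m ≃ₜ X m, (∀ q ∈ F, g q = h q) → MapsTo g A U := by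
  classical
  have h0 : ∀ x : X m, ∃ (F : Finset (X m)) (V : Set (X m)), x ∈ A → (∀ q ∈ F, Br q) ∧
      IsOpen V ∧ x ∈ V ∧ ∀ g : X m ≃ₜ X m, (∀ q ∈ F, g q = q) → MapsTo g V (h ⁻¹' U) := by
    intro x
    by_cases hx : x ∈ A
    · obtain ⟨F, hF, V, h1, h2, h3⟩ := localA (hU.preimage h.continuous) (hAU hx)
      exact ⟨F, V, fun _ => ⟨hF, h1, h2, h3⟩⟩
    · exact ⟨∅, ∅, fun h => absurd h hx⟩
  choose F V h0 using h0
  obtain ⟨T, hT, hcov⟩ := hA.elim_nhds_subcover V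
    (fun x hx => (h0 x hx).2.1.mem_nhds (h0 x hx).2.2.1)
  refine ⟨T.biUnion F, ?_, ?_⟩
  · intro q hq
    obtain ⟨x, hx, hq⟩ := Finset.mem_biUnion.1 hq
    exact (h0 x (hT x hx)).1 q hq
  · intro g hg a ha
    obtain ⟨x, hx, hax⟩ := mem_iUnion₂.1 (hcov ha)
    have := (h0 x (hT x hx)).2.2.2 (h⁻¹ * g) (fun q hq => by
      rw [hmul, hg q (Finset.mem_biUnion.2 ⟨x, hx, hq⟩), hinv_mul]) hax
    have h2 : h ((h⁻¹ * g) a) ∈ U := this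
    rwa [hmul, hmul_inv] at h2

lemma G_dense : Dense (G m : Set (X m ≃ₜ X m)) := by
  classical
  intro h
  have h0 : ∀ F : Finset (X m), ∃ g ∈ G m, ∀ q ∈ F.filter Br, g q = h q := fun F =>
    approx h _ fun q hq => (Finset.mem_filter.1 hq).2
  choose g hg hgF using h0
  have ht : Filter.Tendsto g Filter.atTop (𝓝 h) := by
    have hind : 𝓝 h = Filter.comap (fun h : X m ≃ₜ X m => (h : C(X m, X m)))
        (𝓝 (h : C(X m, X m))) := nhds_induced _ _
    rw [hind, Filter.tendsto_comap_iff, ContinuousMap.tendsto_nhds_compactOpen]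
    intro A hA U hU hAU
    obtain ⟨F0, hF0, hF⟩ := globalA h hA hU hAU
    filter_upwards [Filter.eventually_ge_atTop F0] with F hle
    exact hF (g F) fun q hq => hgF F q (Finset.mem_filter.2 ⟨hle hq, hF0 q hq⟩)
  exact mem_closure_of_tendsto ht (Filter.Eventually.of_forall hg)

lemma trans2' {p a b : X m} (hp : Br p) (ha : Br a) (hb : Br b) (h1 : a ≠ p) (h2 : b ≠ p) :
    ∃ u ∈ G m, u p = p ∧ u a = b := by
  obtain ⟨u, hu, u1, u2⟩ := trans2 hp ha h1
  obtain ⟨v, hv, v1, v2⟩ := trans2 hp hb h2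
  exact ⟨v⁻¹ * u, mul_mem (inv_mem hv) hu, by rw [hmul, u1, ← v1, hinv_mul],
    by rw [hmul, u2, ← v2, hinv_mul]⟩

lemma maximal {p : X m} (hp : Br p) : pointStab (G m) p ≠ ⊤ ∧
    ∀ H : Subgroup (G m), pointStab (G m) p ≤ H → H = pointStab (G m) p ∨ H = ⊤ := by
  constructor
  · intro htop
    have hq : ∃ q : X m, Br q ∧ q ≠ p := by
      by_cases h : p = c
      · refine ⟨f 0 c, Br_f 0 Br_c, fun e => ?_⟩
        rw [h] at e
        exact c_ne_ι (f_eq_c.1 e)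
      · exact ⟨c, Br_c, fun e => h e.symm⟩
    obtain ⟨q, hq, hne⟩ := hq
    obtain ⟨g, hg, e⟩ := G_trans hp hq
    have : (⟨g, hg⟩ : G m) ∈ pointStab (G m) p := by rw [htop]; trivial
    have : g p = p := this
    exact hne (e.symm.trans this)
  · intro H hH
    by_cases hle : H ≤ pointStab (G m) p
    · exact Or.inl (le_antisymm hle hH)
    right
    obtain ⟨k, hk, hkp⟩ := SetLike.not_le_iff_exists.1 hle
    have hkp : (k : X m ≃ₜ X m) p ≠ p := hkp
    rw [eq_top_iff]
    intro g _
    by_cases hgp : (g : X m ≃ₜ X m) p = p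
    · exact hH hgp
    obtain ⟨u, hu, u1, u2⟩ := trans2' hp ((Br_homeo (k : X m ≃ₜ X m)).2 hp)
      ((Br_homeo (g : X m ≃ₜ X m)).2 hp) hkp hgp
    have huH : (⟨u, hu⟩ : G m) ∈ H := hH u1
    have hs : g⁻¹ * (⟨u, hu⟩ * k) ∈ H := by
      apply hH
      show (g : X m ≃ₜ X m)⁻¹ (u ((k : X m ≃ₜ X m) p)) = p
      rw [u2, hinv_mul]
    have : g = (⟨u, hu⟩ * k) * (g⁻¹ * (⟨u, hu⟩ * k))⁻¹ := by group
    rw [this]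
    exact mul_mem (mul_mem huH hk) (inv_mem hs)

end Waz
end

theorem statement9 (n : ℕ) (hn : 3 ≤ n) :
    ∃ (X : Type) (_ : TopologicalSpace X) (_ : IsWazewskiDendrite n X)
      (G : Subgroup (X ≃ₜ X)),
      G.FG ∧ Dense (G : Set (X ≃ₜ X)) ∧
      ∀ p : X, ptOrder X p = n →
        pointStab G p ≠ ⊤ ∧
        ∀ H : Subgroup G, pointStab G p ≤ H → H = pointStab G p ∨ H = ⊤ := by
  obtain ⟨m, rfl⟩ : ∃ m, n = m + 3 := ⟨n - 3, by omega⟩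
  exact ⟨Waz.X m, inferInstance, Waz.isWaz, Waz.G m, Waz.G_fg, Waz.G_dense,
    fun p hp => Waz.maximal ((Waz.Br_iff p).2 hp)⟩
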